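/- Every signed eulerian graph containing an even number of negative edges has a signed circuit double cover. -/

import Mathlib

open scoped Classical

noncomputable section

/-- A signed (multi)graph: a finite multigraph (loops and multiple edges allowed)
together with a sign on each edge (`neg e = true` means `e` is negative). -/
structure SignedMultigraph where
  V : Type
  E : Type
  [fintypeV : Fintype V]
  [fintypeE : Fintype E]
  ends : E → Sym2 V
  neg : E → Bool

attribute [instance] SignedMultigraph.fintypeV SignedMultigraph.fintypeE

namespace SignedMultigraph

variable (G : SignedMultigraph)

/-- The vertices incident with at least one edge of `S`. -/
def support (S : Finset G.E) : Finset G.V :=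
  Finset.univ.filter fun v => ∃ e ∈ S, v ∈ G.ends e

/-- Degree of `v` in the edge set `S`; loops count twice. -/
def degIn (S : Finset G.E) (v : G.V) : ℕ :=
  ∑ e ∈ S, (if G.ends e = Sym2.diag v then 2 else if v ∈ G.ends e then 1 else 0)

/-- `u` and `v` are joined by an edge of `S`. -/
def Adj (S : Finset G.E) (u v : G.V) : Prop := ∃ e ∈ S, G.ends e = s(u, v)

/-- Reachability using only edges of `S`. -/
def Reach (S : Finset G.E) : G.V → G.V → Prop := Relation.ReflTransGen (G.Adj S)

/-- The subgraph with edge set `S` (and vertex set its support) is connected. -/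
def ConnOn (S : Finset G.E) : Prop :=
  ∀ u ∈ G.support S, ∀ v ∈ G.support S, G.Reach S u v

/-- The whole signed graph is connected. -/
def Connected : Prop := Nonempty G.V ∧ ∀ u v : G.V, G.Reach Finset.univ u v

/-- The negative edges among `S`. -/
def negEdges (S : Finset G.E) : Finset G.E := S.filter fun e => G.neg e = true

/-- A circuit: a (nonempty) connected 2-regular subgraph, given by its edge set. -/
def IsCircuit (S : Finset G.E) : Prop :=
  S.Nonempty ∧ G.ConnOn S ∧ ∀ v ∈ G.support S, G.degIn S v = 2

/-- A balanced circuit: a circuit with an even number of negative edges. -/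
def IsBalancedCircuit (S : Finset G.E) : Prop :=
  G.IsCircuit S ∧ Even (G.negEdges S).card

/-- An unbalanced circuit: a circuit with an odd number of negative edges. -/
def IsUnbalancedCircuit (S : Finset G.E) : Prop :=
  G.IsCircuit S ∧ ¬ Even (G.negEdges S).card

/-- A short barbell: two unbalanced circuits meeting at exactly one vertex. -/
def IsShortBarbell (S : Finset G.E) : Prop :=
  ∃ C₁ C₂ : Finset G.E, G.IsUnbalancedCircuit C₁ ∧ G.IsUnbalancedCircuit C₂ ∧
    Disjoint C₁ C₂ ∧ (G.support C₁ ∩ G.support C₂).card = 1 ∧ S = C₁ ∪ C₂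

/-- A path with (distinct) ends `u` and `v`, given by its edge set. -/
def IsPath (P : Finset G.E) (u v : G.V) : Prop :=
  P.Nonempty ∧ G.ConnOn P ∧ u ≠ v ∧ u ∈ G.support P ∧ v ∈ G.support P ∧
    G.degIn P u = 1 ∧ G.degIn P v = 1 ∧
    ∀ w ∈ G.support P, w ≠ u → w ≠ v → G.degIn P w = 2

/-- A long barbell: two vertex-disjoint unbalanced circuits joined by a path
meeting the circuits only at its ends. -/
def IsLongBarbell (S : Finset G.E) : Prop :=
  ∃ (C₁ C₂ P : Finset G.E) (u v : G.V),
    G.IsUnbalancedCircuit C₁ ∧ G.IsUnbalancedCircuit C₂ ∧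
    Disjoint (G.support C₁) (G.support C₂) ∧
    G.IsPath P u v ∧
    G.support P ∩ G.support C₁ = {u} ∧ G.support P ∩ G.support C₂ = {v} ∧
    Disjoint P C₁ ∧ Disjoint P C₂ ∧
    S = C₁ ∪ C₂ ∪ P

/-- A signed circuit: a balanced circuit, a short barbell, or a long barbell. -/
def IsSignedCircuit (S : Finset G.E) : Prop :=
  G.IsBalancedCircuit S ∨ G.IsShortBarbell S ∨ G.IsLongBarbell S

/-- The number of members of the family `F` containing the edge `e`. -/
def coverCount (F : Multiset (Finset G.E)) (e : G.E) : ℕ :=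
  (F.filter fun S => e ∈ S).card

/-- The total length of the family `F`. -/
def coverLength (F : Multiset (Finset G.E)) : ℕ := (F.map Finset.card).sum

/-- A signed circuit cover: every edge is in at least one member. -/
def IsSignedCircuitCover (F : Multiset (Finset G.E)) : Prop :=
  (∀ S ∈ F, G.IsSignedCircuit S) ∧ ∀ e : G.E, 1 ≤ G.coverCount F e

/-- The length of a shortest signed circuit cover. -/
def SCC : ℕ := sInf { n | ∃ F, G.IsSignedCircuitCover F ∧ G.coverLength F = n }

/-- Whether edge `e` has exactly one endpoint in the vertex set `A`. -/
def crossesB (A : Finset G.V) (e : G.E) : Bool :=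
  Sym2.lift ⟨fun x y => Bool.xor (decide (x ∈ A)) (decide (y ∈ A)),
    fun x y => Bool.xor_comm _ _⟩ (G.ends e)

/-- Sign of `e` (`true` = negative) after switching at every vertex of `A`. -/
def negAfter (A : Finset G.V) (e : G.E) : Bool :=
  Bool.xor (G.neg e) (G.crossesB A e)

/-- Minimum number of negative edges in `S` over all switchings. -/
def negOf (S : Finset G.E) : ℕ :=
  sInf { n | ∃ A : Finset G.V, (S.filter fun e => G.negAfter A e = true).card = n }

/-- The negativeness of `G`. -/
def negativeness : ℕ := G.negOf Finset.univ

/-- The edges of `S` with exactly one endpoint in `U`: the edge boundary `δ(U)` inside `S`. -/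
def boundary (S : Finset G.E) (U : Finset G.V) : Finset G.E :=
  S.filter fun e => G.crossesB U e = true

/-- `b` is a bridge of the subgraph with edge set `S`. -/
def IsBridge (S : Finset G.E) (b : G.E) : Prop :=
  ∃ U : Finset G.V, G.boundary S U = {b}

/-- The subgraph with edge set `S` is bridgeless. -/
def Bridgeless (S : Finset G.E) : Prop := ∀ b ∈ S, ¬ G.IsBridge S b

/-- `G` is 2-edge-connected. -/
def TwoEdgeConnected : Prop :=
  G.Connected ∧ ∀ b : G.E, ¬ G.IsBridge Finset.univ b

/-- Edges of `S` lying in the same component (of the subgraph with edge set `S`)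
as the vertex `x`. -/
def compEdges (S : Finset G.E) (x : G.V) : Finset G.E :=
  S.filter fun e => ∃ u, u ∈ G.ends e ∧ G.Reach S x u

/-- A g-bridge: a bridge such that both components of `G - b` have even negativeness. -/
def IsGBridge (b : G.E) : Prop :=
  G.IsBridge Finset.univ b ∧
    ∃ x y : G.V, G.ends b = s(x, y) ∧
      Even (G.negOf (G.compEdges (Finset.univ.erase b) x)) ∧
      Even (G.negOf (G.compEdges (Finset.univ.erase b) y))

/-- `G` has no g-bridge (in any of its components). -/
def GBridgeless : Prop := ∀ b : G.E, ¬ G.IsGBridge b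

/-- Member of `B_g(G)`: a bridge such that at least one component of `G - b`
contains an odd number of negative edges. -/
def IsBgBridge (b : G.E) : Prop :=
  G.IsBridge Finset.univ b ∧
    ∃ x : G.V, x ∈ G.ends b ∧
      ¬ Even (G.negEdges (G.compEdges (Finset.univ.erase b) x)).card

/-- Member of `B_s(G)`: a bridge such that each of the two components of `G - b`
contains a negative edge. -/
def IsSBridge (b : G.E) : Prop :=
  G.IsBridge Finset.univ b ∧
    ∃ x y : G.V, G.ends b = s(x, y) ∧
      (G.negEdges (G.compEdges (Finset.univ.erase b) x)).Nonempty ∧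
      (G.negEdges (G.compEdges (Finset.univ.erase b) y)).Nonempty

/-- `G` is s-bridgeless: every edge lies in some signed circuit. -/
def SBridgeless : Prop := ∀ e : G.E, ∃ S : Finset G.E, G.IsSignedCircuit S ∧ e ∈ S

/-- `{e, f}` is a 2-edge-cut of `G`. -/
def IsTwoEdgeCut (e f : G.E) : Prop :=
  e ≠ f ∧ ∃ U : Finset G.V, G.boundary Finset.univ U = {e, f}

/-- `S_G(e) = {e} ∪ {f : {e,f} is a 2-edge-cut of G}`. -/
def SSet (e : G.E) : Finset G.E :=
  insert e (Finset.univ.filter fun f => G.IsTwoEdgeCut e f)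

/-- The edge set `R` spans an acyclic subgraph (every nonempty subset has a
vertex of degree one). -/
def AcyclicSet (R : Finset G.E) : Prop :=
  ∀ F ⊆ R, F.Nonempty → ∃ v : G.V, G.degIn F v = 1

/-- `T` is the edge set of a spanning tree of `G`. -/
def IsSpanningTree (T : Finset G.E) : Prop :=
  G.AcyclicSet T ∧ Nonempty G.V ∧ ∀ u v : G.V, G.Reach T u v

/-- `G` is eulerian: connected with all degrees even. -/
def Eulerian : Prop :=
  G.Connected ∧ ∀ v : G.V, Even (G.degIn Finset.univ v)

/-- The edge set `S` spans an eulerian subgraph. -/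
def IsEulerianSub (S : Finset G.E) : Prop :=
  S.Nonempty ∧ G.ConnOn S ∧ ∀ v ∈ G.support S, Even (G.degIn S v)

/-- The vertex class of `v` after contracting each member of `ℬ`. -/
def classOf (ℬ : Finset (Finset G.E)) (v : G.V) : Finset G.V :=
  Finset.univ.filter fun u => u = v ∨ ∃ B ∈ ℬ, v ∈ G.support B ∧ u ∈ G.support B

/-- Degree, in edge set `F`, of the contracted class of `v`. -/
def classDeg (ℬ : Finset (Finset G.E)) (F : Finset G.E) (v : G.V) : ℕ :=
  ∑ u ∈ G.classOf ℬ v, G.degIn F u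

/-- `ℬ` witnesses that the subgraph with edge set `S` is a generalized barbell:
`ℬ` is a family of vertex-disjoint eulerian subgraphs of `S`, the contraction
`S/(∪ℬ)` is acyclic, and for every vertex `x` of the contracted graph,
`|E_N(B_x)| ≡ |δ(V(B_x))| (mod 2)`. -/
def GenBarbellWitness (S : Finset G.E) (ℬ : Finset (Finset G.E)) : Prop :=
  (∀ B ∈ ℬ, B ⊆ S ∧ G.IsEulerianSub B) ∧
  (∀ B₁ ∈ ℬ, ∀ B₂ ∈ ℬ, B₁ ≠ B₂ → Disjoint (G.support B₁) (G.support B₂)) ∧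
  (∀ F ⊆ S \ ℬ.sup id, F.Nonempty → ∃ v : G.V, G.classDeg ℬ F v = 1) ∧
  (∀ B ∈ ℬ, (G.negEdges B).card ≡ (G.boundary S (G.support B)).card [MOD 2]) ∧
  (∀ v ∈ G.support S, (∀ B ∈ ℬ, v ∉ G.support B) → Even (G.boundary S {v}).card)

/-- The subgraph with edge set `S` is a generalized barbell. -/
def IsGenBarbell (S : Finset G.E) : Prop := ∃ ℬ, G.GenBarbellWitness S ℬ

end SignedMultigraph

namespace SignedMultigraph

variable {G : SignedMultigraph}

theorem mem_support {S : Finset G.E} {v : G.V} :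
    v ∈ G.support S ↔ ∃ e ∈ S, v ∈ G.ends e := by
  simp [support]

theorem support_mono {S T : Finset G.E} (h : S ⊆ T) : G.support S ⊆ G.support T := by
  intro v hv
  obtain ⟨e, he, hve⟩ := mem_support.1 hv
  exact mem_support.2 ⟨e, h he, hve⟩

theorem support_union (S T : Finset G.E) :
    G.support (S ∪ T) = G.support S ∪ G.support T := by
  ext v
  simp only [mem_support, Finset.mem_union]
  grind

theorem exists_mem_ends (e : G.E) : ∃ v, v ∈ G.ends e := by
  induction h : G.ends e with
  | _ x y => exact ⟨x, by simp⟩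

theorem support_nonempty {S : Finset G.E} (h : S.Nonempty) : (G.support S).Nonempty := by
  obtain ⟨e, he⟩ := h
  obtain ⟨v, hv⟩ := exists_mem_ends e
  exact ⟨v, mem_support.2 ⟨e, he, hv⟩⟩

theorem disjoint_of_disjoint_support {S T : Finset G.E}
    (h : Disjoint (G.support S) (G.support T)) : Disjoint S T := by
  rw [Finset.disjoint_left] at h ⊢
  intro e he he'
  obtain ⟨v, hv⟩ := exists_mem_ends e
  exact h (mem_support.2 ⟨e, he, hv⟩) (mem_support.2 ⟨e, he', hv⟩)

theorem support_singleton {e : G.E} {x y : G.V} (h : G.ends e = s(x, y)) :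
    G.support {e} = {x, y} := by
  ext v
  simp [mem_support, h]

theorem degIn_union {S T : Finset G.E} (h : Disjoint S T) (v : G.V) :
    G.degIn (S ∪ T) v = G.degIn S v + G.degIn T v :=
  Finset.sum_union h

theorem degIn_sdiff {S T : Finset G.E} (h : T ⊆ S) (v : G.V) :
    G.degIn (S \ T) v + G.degIn T v = G.degIn S v :=
  Finset.sum_sdiff h

theorem degIn_mono {S T : Finset G.E} (h : S ⊆ T) (v : G.V) :
    G.degIn S v ≤ G.degIn T v :=
  Finset.sum_le_sum_of_subset h

theorem degIn_eq_zero_iff {S : Finset G.E} {v : G.V} :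
    G.degIn S v = 0 ↔ v ∉ G.support S := by
  rw [degIn, Finset.sum_eq_zero_iff, mem_support]
  push Not
  refine forall₂_congr fun e _ => ?_
  split_ifs with h1 h2
  · simp [h1, Sym2.diag]
  · simp [h2]
  · simp [h2]

theorem mem_support_of_odd {S : Finset G.E} {v : G.V} (h : Odd (G.degIn S v)) :
    v ∈ G.support S := by
  by_contra hv
  rw [degIn_eq_zero_iff.2 hv] at h
  simp at h

theorem degIn_singleton_of_ne {e : G.E} {x y : G.V} (h : G.ends e = s(x, y)) (hxy : x ≠ y)
    (v : G.V) : G.degIn {e} v = if v = x ∨ v = y then 1 else 0 := by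
  simp only [degIn, Finset.sum_singleton, h, Sym2.diag, Sym2.mem_iff]
  split_ifs <;> simp_all

theorem degIn_singleton_loop {e : G.E} {x : G.V} (h : G.ends e = s(x, x)) :
    G.degIn {e} x = 2 := by
  simp [degIn, h, Sym2.diag]

theorem sum_degIn (S : Finset G.E) : ∑ v, G.degIn S v = 2 * S.card := by
  unfold degIn
  rw [Finset.sum_comm, mul_comm, ← smul_eq_mul, ← Finset.sum_const]
  refine Finset.sum_congr rfl fun e _ => ?_
  induction h : G.ends e with
  | _ x y =>
    by_cases hxy : x = y
    · subst hxy
      rw [Finset.sum_eq_single x]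
      · simp [Sym2.diag]
      · intro v _ hv
        simp [Sym2.diag, hv, hv.symm]
      · simp
    · have : ∀ v, (if s(x, y) = Sym2.diag v then 2 else if v ∈ s(x, y) then 1 else 0)
          = (if v = x then 1 else 0) + (if v = y then 1 else 0) := by
        intro v
        simp only [Sym2.diag, Sym2.mem_iff]
        split_ifs <;> simp_all
      rw [Finset.sum_congr rfl fun v _ => this v, Finset.sum_add_distrib]
      simp

/-- A set of edges with exactly two distinguished vertices outside of which degrees are even:
if one of the two degrees is odd, then so is the other one. -/
theorem odd_degIn_of_odd_degIn {S : Finset G.E} {u v : G.V} (huv : u ≠ v)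
    (h : ∀ w, w ≠ u → w ≠ v → Even (G.degIn S w)) (hu : Odd (G.degIn S u)) :
    Odd (G.degIn S v) := by
  have h1 := sum_degIn S
  rw [← Finset.add_sum_erase _ _ (Finset.mem_univ u),
    ← Finset.add_sum_erase _ _ (Finset.mem_erase.2 ⟨huv.symm, Finset.mem_univ v⟩)] at h1
  have h2 : Even (∑ w ∈ (Finset.univ.erase u).erase v, G.degIn S w) := by
    refine Finset.even_sum _ fun w hw => ?_
    simp only [Finset.mem_erase, Finset.mem_univ, and_true] at hw
    exact h w hw.2 hw.1
  grind

theorem reach_mono {S T : Finset G.E} (h : S ⊆ T) {u v : G.V} (hr : G.Reach S u v) :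
    G.Reach T u v :=
  Relation.ReflTransGen.mono (fun _ _ ⟨e, he, h'⟩ => ⟨e, h he, h'⟩) _ _ hr

theorem Reach.trans {S : Finset G.E} {u v w : G.V} (h : G.Reach S u v) (h' : G.Reach S v w) :
    G.Reach S u w :=
  Relation.ReflTransGen.trans h h'

theorem Reach.symm {S : Finset G.E} {u v : G.V} (h : G.Reach S u v) : G.Reach S v u := by
  induction h with
  | refl => exact Relation.ReflTransGen.refl
  | tail _ hbc ih =>
    obtain ⟨e, he, h'⟩ := hbc
    exact Relation.ReflTransGen.head ⟨e, he, by rw [h', Sym2.eq_swap]⟩ ih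

theorem reach_of_mem_ends {S : Finset G.E} {e : G.E} (he : e ∈ S) {u v : G.V}
    (hu : u ∈ G.ends e) (hv : v ∈ G.ends e) : G.Reach S u v := by
  by_cases huv : u = v
  · subst huv
    exact Relation.ReflTransGen.refl
  · exact Relation.ReflTransGen.single ⟨e, he, (Sym2.mem_and_mem_iff huv).1 ⟨hu, hv⟩⟩

theorem connOn_singleton (e : G.E) : G.ConnOn {e} := by
  intro u hu v hv
  simp only [mem_support, Finset.mem_singleton, exists_eq_left] at hu hv
  exact reach_of_mem_ends (Finset.mem_singleton_self e) hu hv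

theorem connOn_of_reach {S : Finset G.E} {x : G.V}
    (h : ∀ u ∈ G.support S, G.Reach S u x) : G.ConnOn S :=
  fun u hu v hv => (h u hu).trans (h v hv).symm

theorem ConnOn.union {S T : Finset G.E} (hS : G.ConnOn S) (hT : G.ConnOn T) {x : G.V}
    (hxS : x ∈ G.support S) (hxT : x ∈ G.support T) : G.ConnOn (S ∪ T) := by
  refine connOn_of_reach (x := x) fun u hu => ?_
  rw [support_union, Finset.mem_union] at hu
  rcases hu with hu | hu
  · exact reach_mono Finset.subset_union_left (hS u hu x hxS)
  · exact reach_mono Finset.subset_union_right (hT u hu x hxT)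

/-- If `D` contains a connected set `T` and is separated from the rest of the connected set `S`
away from `T`, then `D` is connected. -/
theorem connOn_of_separated {S T D : Finset G.E} (hS : G.ConnOn S) (hT : G.ConnOn T)
    (hTn : T.Nonempty) (hTD : T ⊆ D) (hDS : D ⊆ S)
    (h : ∀ v ∈ G.support (D \ T), v ∈ G.support (S \ D) → v ∈ G.support T) : G.ConnOn D := by
  obtain ⟨t, ht⟩ := support_nonempty hTn
  have key : ∀ u, G.Reach S u t → u ∈ G.support D → G.Reach D u t := by
    intro u hr
    induction hr using Relation.ReflTransGen.head_induction_on with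
    | refl => exact fun _ => Relation.ReflTransGen.refl
    | @head a c hab _ ih =>
      intro ha
      obtain ⟨e, heS, he⟩ := hab
      by_cases haT : a ∈ G.support T
      · exact reach_mono hTD (hT a haT t ht)
      by_cases heD : e ∈ D
      · have hc : c ∈ G.support D := mem_support.2 ⟨e, heD, by simp [he]⟩
        exact Reach.trans (reach_of_mem_ends heD (by simp [he]) (by simp [he])) (ih hc)
      · exfalso
        obtain ⟨f, hf, haf⟩ := mem_support.1 ha
        have hfT : f ∉ T := fun hfT => haT (mem_support.2 ⟨f, hfT, haf⟩)
        exact haT (h a (mem_support.2 ⟨f, by simp [hf, hfT], haf⟩)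
          (mem_support.2 ⟨e, by simp [heS, heD], by simp [he]⟩))
  refine connOn_of_reach (x := t) fun u hu => key u ?_ hu
  exact hS u (support_mono hDS hu) t (support_mono (hTD.trans hDS) ht)

theorem compEdges_subset (S : Finset G.E) (x : G.V) : G.compEdges S x ⊆ S :=
  Finset.filter_subset _ _

theorem mem_compEdges_of_reach {S : Finset G.E} {x u : G.V} {e : G.E} (he : e ∈ S)
    (hu : u ∈ G.ends e) (hr : G.Reach S x u) : e ∈ G.compEdges S x := by
  simp only [compEdges, Finset.mem_filter]
  exact ⟨he, u, hu, hr⟩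

theorem reach_of_mem_support_compEdges {S : Finset G.E} {x u : G.V}
    (hu : u ∈ G.support (G.compEdges S x)) : G.Reach S x u := by
  obtain ⟨e, he, hue⟩ := mem_support.1 hu
  simp only [compEdges, Finset.mem_filter] at he
  obtain ⟨heS, w, hw, hr⟩ := he
  exact hr.trans (reach_of_mem_ends heS hw hue)

theorem support_compEdges_disjoint (S : Finset G.E) (x : G.V) :
    Disjoint (G.support (G.compEdges S x)) (G.support (S \ G.compEdges S x)) := by
  rw [Finset.disjoint_left]
  intro u hu hu'
  obtain ⟨e, he, hue⟩ := mem_support.1 hu'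
  rw [Finset.mem_sdiff] at he
  exact he.2 (mem_compEdges_of_reach he.1 hue (reach_of_mem_support_compEdges hu))

theorem mem_support_compEdges {S : Finset G.E} {x u : G.V} (hu : u ∈ G.support S)
    (hr : G.Reach S x u) : u ∈ G.support (G.compEdges S x) := by
  obtain ⟨e, he, hue⟩ := mem_support.1 hu
  exact mem_support.2 ⟨e, mem_compEdges_of_reach he hue hr, hue⟩

theorem reach_compEdges {S : Finset G.E} {x u : G.V} (hr : G.Reach S x u) :
    G.Reach (G.compEdges S x) x u := by
  induction hr with
  | refl => exact Relation.ReflTransGen.refl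
  | tail hab hbc ih =>
    obtain ⟨e, heS, he⟩ := hbc
    refine ih.tail ⟨e, mem_compEdges_of_reach heS ?_ hab, he⟩
    simp [he]

theorem connOn_compEdges (S : Finset G.E) (x : G.V) : G.ConnOn (G.compEdges S x) :=
  connOn_of_reach (x := x) fun _ hu =>
    (reach_compEdges (reach_of_mem_support_compEdges hu)).symm

theorem degIn_compEdges_of_mem {S : Finset G.E} {x u : G.V}
    (hu : u ∈ G.support (G.compEdges S x)) : G.degIn (G.compEdges S x) u = G.degIn S u := by
  have h := degIn_sdiff (compEdges_subset S x) u
  rw [degIn_eq_zero_iff.2 (Finset.disjoint_left.1 (support_compEdges_disjoint S x) hu)] at h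
  omega

/-- Removing from a connected set a component of the complement of a connected subset
leaves a connected set. -/
theorem connOn_sdiff_compEdges {S T : Finset G.E} (hS : G.ConnOn S) (hT : G.ConnOn T)
    (hTn : T.Nonempty) (hTS : T ⊆ S) (x : G.V) :
    G.ConnOn (S \ G.compEdges (S \ T) x) := by
  have hsub := compEdges_subset (S \ T) x
  refine connOn_of_separated hS hT hTn (D := S \ G.compEdges (S \ T) x) ?_
    Finset.sdiff_subset ?_
  · intro e he
    exact Finset.mem_sdiff.2 ⟨hTS he, fun h => (Finset.mem_sdiff.1 (hsub h)).2 he⟩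
  · intro v hv hv'
    exfalso
    have hd := support_compEdges_disjoint (S \ T) x
    refine Finset.disjoint_left.1 hd (support_mono ?_ hv') (support_mono ?_ hv)
    · intro e he
      simp only [Finset.mem_sdiff] at he
      tauto
    · intro e he
      simp only [Finset.mem_sdiff] at he ⊢
      tauto

/-- Every degree inside `S` is even. -/
def EvenDeg (S : Finset G.E) : Prop := ∀ v, Even (G.degIn S v)

theorem EvenDeg.sdiff {S T : Finset G.E} (hS : EvenDeg S) (hT : EvenDeg T) (h : T ⊆ S) :
    EvenDeg (S \ T) := by
  intro v
  have h1 := degIn_sdiff h v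
  have h2 := hS v
  have h3 := hT v
  rw [← h1, Nat.even_add] at h2
  exact h2.2 h3

theorem EvenDeg.compEdges {S : Finset G.E} (hS : EvenDeg S) (x : G.V) :
    EvenDeg (G.compEdges S x) := by
  intro v
  by_cases hv : v ∈ G.support (G.compEdges S x)
  · rw [degIn_compEdges_of_mem hv]
    exact hS v
  · rw [degIn_eq_zero_iff.2 hv]
    exact Even.zero

theorem IsCircuit.evenDeg {C : Finset G.E} (hC : G.IsCircuit C) : EvenDeg C := by
  intro v
  by_cases hv : v ∈ G.support C
  · rw [hC.2.2 v hv]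
    exact even_two
  · rw [degIn_eq_zero_iff.2 hv]
    exact Even.zero

theorem negEdges_union {S T : Finset G.E} (h : Disjoint S T) :
    (G.negEdges (S ∪ T)).card = (G.negEdges S).card + (G.negEdges T).card := by
  unfold negEdges
  rw [Finset.filter_union, Finset.card_union_of_disjoint]
  exact Finset.disjoint_filter_filter h

theorem negEdges_sdiff {S T : Finset G.E} (h : T ⊆ S) :
    (G.negEdges (S \ T)).card + (G.negEdges T).card = (G.negEdges S).card := by
  rw [← negEdges_union Finset.sdiff_disjoint, Finset.sdiff_union_of_subset h]

theorem disjoint_of_support_inter {S T : Finset G.E} {v : G.V}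
    (h : ∀ x ∈ G.support S, x ∈ G.support T → x = v) (hd : G.degIn S v < 2) :
    Disjoint S T := by
  rw [Finset.disjoint_left]
  intro e he he'
  have hloop : G.ends e = s(v, v) := by
    have h' : ∀ x ∈ G.ends e, x = v := fun x hx =>
      h x (mem_support.2 ⟨e, he, hx⟩) (mem_support.2 ⟨e, he', hx⟩)
    induction hxy : G.ends e with
    | _ x y => rw [h' x (by simp [hxy]), h' y (by simp [hxy])]
  have h1 := degIn_singleton_loop hloop
  have h2 := degIn_mono (Finset.singleton_subset_iff.2 he) v
  omega

theorem isPath_singleton {e : G.E} {x y : G.V} (h : G.ends e = s(x, y)) (hxy : x ≠ y) :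
    G.IsPath {e} x y := by
  have hd := degIn_singleton_of_ne h hxy
  have hs := support_singleton h
  refine ⟨Finset.singleton_nonempty e, connOn_singleton e, hxy, by simp [hs], by simp [hs],
    by simp [hd], by simp [hd], ?_⟩
  intro w hw h1 h2
  simp [hs, h1, h2] at hw

theorem IsPath.symm {P : Finset G.E} {u v : G.V} (h : G.IsPath P u v) : G.IsPath P v u := by
  obtain ⟨h1, h2, h3, h4, h5, h6, h7, h8⟩ := h
  exact ⟨h1, h2, h3.symm, h5, h4, h7, h6, fun w hw a b => h8 w hw b a⟩

theorem IsPath.ne {P : Finset G.E} {u v : G.V} (h : G.IsPath P u v) : u ≠ v := h.2.2.1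

theorem IsPath.left_mem {P : Finset G.E} {u v : G.V} (h : G.IsPath P u v) :
    u ∈ G.support P := h.2.2.2.1

theorem IsPath.right_mem {P : Finset G.E} {u v : G.V} (h : G.IsPath P u v) :
    v ∈ G.support P := h.2.2.2.2.1

theorem IsPath.append {P Q : Finset G.E} {u v w : G.V} (hP : G.IsPath P u v)
    (hQ : G.IsPath Q v w) (h : ∀ x ∈ G.support P, x ∈ G.support Q → x = v) :
    G.IsPath (P ∪ Q) u w := by
  obtain ⟨p1, p2, p3, p4, p5, p6, p7, p8⟩ := hP
  obtain ⟨q1, q2, q3, q4, q5, q6, q7, q8⟩ := hQ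
  have hdisj : Disjoint P Q := disjoint_of_support_inter h (by omega)
  have hd := degIn_union (G := G) hdisj
  have hP0 : ∀ x, x ∈ G.support P → x ≠ v → G.degIn Q x = 0 := fun x hx hxv =>
    degIn_eq_zero_iff.2 fun hx' => hxv (h x hx hx')
  have hQ0 : ∀ x, x ∈ G.support Q → x ≠ v → G.degIn P x = 0 := fun x hx hxv =>
    degIn_eq_zero_iff.2 fun hx' => hxv (h x hx' hx)
  refine ⟨p1.mono Finset.subset_union_left, p2.union q2 p5 q4, ?_, ?_, ?_, ?_, ?_, ?_⟩
  · rintro rfl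
    exact p3 (h u p4 q5)
  · simp [support_union, p4]
  · simp [support_union, q5]
  · rw [hd, p6, hP0 u p4 p3]
  · rw [hd, q7, hQ0 w q5 q3.symm]
  · intro x hx hxu hxw
    rw [hd]
    by_cases hxv : x = v
    · subst hxv; omega
    rw [support_union, Finset.mem_union] at hx
    rcases hx with hx | hx
    · rw [hP0 x hx hxv, p8 x hx hxu hxv]
    · rw [hQ0 x hx hxv, q8 x hx hxv hxw]

/-- A reachable vertex can be reached without returning to the starting vertex. -/
theorem Reach.exists_last_exit {S : Finset G.E} {u v : G.V} (h : G.Reach S u v) (huv : u ≠ v) :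
    ∃ e ∈ S, ∃ x, x ≠ u ∧ G.ends e = s(u, x) ∧
      G.Reach (S.filter fun e => u ∉ G.ends e) x v := by
  induction h with
  | refl => exact absurd rfl huv
  | @tail b c _ hbc ih =>
    obtain ⟨e, he, hee⟩ := hbc
    by_cases hub : u = b
    · subst hub
      exact ⟨e, he, c, huv.symm, hee, Relation.ReflTransGen.refl⟩
    · obtain ⟨f, hf, x, hx, hfx, hr⟩ := ih hub
      refine ⟨f, hf, x, hx, hfx, hr.tail ⟨e, ?_, hee⟩⟩
      simp [he, hee, hub, huv]

theorem exists_isPath {S : Finset G.E} {u v : G.V} (h : G.Reach S u v) (huv : u ≠ v) :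
    ∃ P ⊆ S, G.IsPath P u v := by
  induction hn : S.card using Nat.strong_induction_on generalizing S u with
  | _ n ih =>
    obtain ⟨e, he, x, hx, hee, hr⟩ := h.exists_last_exit huv
    have h1 := isPath_singleton hee hx.symm
    by_cases hxv : x = v
    · subst hxv
      exact ⟨{e}, by simpa using he, h1⟩
    have hlt : (S.filter fun e => u ∉ G.ends e).card < n := by
      rw [← hn]
      refine Finset.card_lt_card (Finset.filter_ssubset.2 ⟨e, he, ?_⟩)
      simp [hee]
    obtain ⟨P, hPS, hP⟩ := ih _ hlt hr hxv rfl
    refine ⟨{e} ∪ P, ?_, h1.append hP ?_⟩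
    · intro f hf
      rcases Finset.mem_union.1 hf with hf | hf
      · rw [Finset.mem_singleton.1 hf]
        exact he
      · exact (Finset.mem_filter.1 (hPS hf)).1
    · intro z hz hz'
      rw [support_singleton hee] at hz
      simp only [Finset.mem_insert, Finset.mem_singleton] at hz
      rcases hz with rfl | rfl
      · obtain ⟨f, hf, hzf⟩ := mem_support.1 hz'
        exact absurd hzf (Finset.mem_filter.1 (hPS hf)).2
      · rfl

theorem IsPath.split {P : Finset G.E} {u w y : G.V} (hP : G.IsPath P u w)
    (hy : y ∈ G.support P) (hyu : y ≠ u) (hyw : y ≠ w) :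
    ∃ P₁ P₂, Disjoint P₁ P₂ ∧ P₁ ∪ P₂ = P ∧ G.IsPath P₁ u y ∧ G.IsPath P₂ y w ∧
      ∀ x ∈ G.support P₁, x ∈ G.support P₂ → x = y := by
  obtain ⟨R, hRP, hR⟩ := exists_isPath (hP.2.1 u hP.left_mem y hy) hyu.symm
  obtain ⟨p1, p2, p3, p4, p5, p6, p7, p8⟩ := hP
  obtain ⟨r1, r2, r3, r4, r5, r6, r7, r8⟩ := id hR
  have hd := degIn_sdiff (G := G) hRP
  have hw0 : w ∉ G.support R := by
    intro hwR
    have h1 := r8 w hwR p3.symm hyw.symm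
    have h2 := hd w
    omega
  have hwR : G.degIn R w = 0 := degIn_eq_zero_iff.2 hw0
  have hint : ∀ x ∈ G.support R, x ∈ G.support (P \ R) → x = y := by
    intro x hx hx'
    by_contra hxy
    have h0 : G.degIn (P \ R) x ≠ 0 := fun h => degIn_eq_zero_iff.1 h hx'
    have h1 := hd x
    by_cases hxu : x = u
    · subst hxu; omega
    by_cases hxw : x = w
    · subst hxw; exact hw0 hx
    have h2 := r8 x hx hxu hxy
    have h3 := p8 x (support_mono hRP hx) hxu hxw
    omega
  have hdy : G.degIn (P \ R) y = 1 := by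
    have := hd y
    have := p8 y hy hyu hyw
    omega
  have hys : y ∈ G.support (P \ R) := mem_support_of_odd (by simp [hdy])
  have hdw : G.degIn (P \ R) w = 1 := by
    have := hd w
    omega
  refine ⟨R, P \ R, Finset.disjoint_sdiff, Finset.union_sdiff_of_subset hRP, hR, ?_, hint⟩
  refine ⟨?_, ?_, hyw, hys, mem_support_of_odd (by simp [hdw]), hdy, hdw, ?_⟩
  · obtain ⟨e, he, _⟩ := mem_support.1 hys
    exact ⟨e, he⟩
  · obtain ⟨e, he, hye⟩ := mem_support.1 hys
    refine connOn_of_separated p2 (connOn_singleton e) (Finset.singleton_nonempty e)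
      (Finset.singleton_subset_iff.2 he) Finset.sdiff_subset ?_
    intro v hv hv'
    rw [Finset.sdiff_sdiff_eq_self hRP] at hv'
    rw [hint v hv' (support_mono Finset.sdiff_subset hv)]
    exact mem_support.2 ⟨e, by simp, hye⟩
  · intro x hx hxy hxw
    have hxR : x ∉ G.support R := fun h => hxy (hint x h hx)
    have h1 := hd x
    rw [degIn_eq_zero_iff.2 hxR] at h1
    have hxu : x ≠ u := by
      rintro rfl
      exact hxR r4
    rw [← p8 x (support_mono Finset.sdiff_subset hx) hxu hxw]
    omega

/-- A connected edge set whose vertices of odd degree are exactly `u` and `v`. -/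
def IsJoin (R : Finset G.E) (u v : G.V) : Prop :=
  G.ConnOn R ∧ Odd (G.degIn R u) ∧ Odd (G.degIn R v) ∧
    ∀ w, w ≠ u → w ≠ v → Even (G.degIn R w)

theorem IsPath.isJoin {P : Finset G.E} {u v : G.V} (h : G.IsPath P u v) : IsJoin P u v := by
  obtain ⟨h1, h2, h3, h4, h5, h6, h7, h8⟩ := h
  refine ⟨h2, by simp [h6], by simp [h7], fun w hu hv => ?_⟩
  by_cases hw : w ∈ G.support P
  · rw [h8 w hw hu hv]
    exact even_two
  · rw [degIn_eq_zero_iff.2 hw]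
    exact Even.zero

theorem IsJoin.left_mem {R : Finset G.E} {u v : G.V} (h : IsJoin R u v) : u ∈ G.support R :=
  mem_support_of_odd h.2.1

theorem IsJoin.right_mem {R : Finset G.E} {u v : G.V} (h : IsJoin R u v) : v ∈ G.support R :=
  mem_support_of_odd h.2.2.1

theorem IsJoin.evenDeg_union {R T : Finset G.E} {u v : G.V} (hR : IsJoin R u v)
    (hT : IsJoin T u v) (h : Disjoint R T) : EvenDeg (R ∪ T) := by
  intro w
  rw [degIn_union h]
  by_cases hu : w = u
  · subst hu
    exact hR.2.1.add_odd hT.2.1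
  by_cases hv : w = v
  · subst hv
    exact hR.2.2.1.add_odd hT.2.2.1
  exact (hR.2.2.2 w hu hv).add (hT.2.2.2 w hu hv)

theorem IsJoin.sdiff {K R : Finset G.E} {u v : G.V} (hK : EvenDeg K) (hRK : R ⊆ K)
    (hR : IsJoin R u v) (hconn : G.ConnOn (K \ R)) : IsJoin (K \ R) u v := by
  have hd := degIn_sdiff (G := G) hRK
  refine ⟨hconn, ?_, ?_, ?_⟩
  · have h1 := hK u
    have h2 := hR.2.1
    rw [← hd u] at h1
    grind
  · have h1 := hK v
    have h2 := hR.2.2.1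
    rw [← hd v] at h1
    grind
  · intro w hwu hwv
    have h1 := hK w
    have h2 := hR.2.2.2 w hwu hwv
    rw [← hd w] at h1
    grind

/-- A connected set with even degrees splits into two connected sets joining any two
of its vertices. -/
theorem exists_join_split {K : Finset G.E} (hK : G.ConnOn K) (hKe : EvenDeg K) {u v : G.V}
    (hu : u ∈ G.support K) (hv : v ∈ G.support K) (huv : u ≠ v) :
    ∃ R₁ R₂, Disjoint R₁ R₂ ∧ R₁ ∪ R₂ = K ∧ IsJoin R₁ u v ∧ IsJoin R₂ u v := by
  obtain ⟨R, hRK, hR⟩ := exists_isPath (hK u hu v hv) huv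
  have hRj := hR.isJoin
  have hd := degIn_sdiff (G := G) hRK
  have hDu : Odd (G.degIn (K \ R) u) := by
    have h1 := hKe u
    have h2 := hRj.2.1
    rw [← hd u] at h1
    grind
  have hDe : ∀ w, w ≠ u → w ≠ v → Even (G.degIn (K \ R) w) := by
    intro w hwu hwv
    have h1 := hKe w
    have h2 := hRj.2.2.2 w hwu hwv
    rw [← hd w] at h1
    grind
  set B := G.compEdges (K \ R) u with hB
  have huB : u ∈ G.support B :=
    mem_support_compEdges (mem_support_of_odd hDu) Relation.ReflTransGen.refl
  have hBu : Odd (G.degIn B u) := by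
    rw [hB, degIn_compEdges_of_mem huB]
    exact hDu
  have hBe : ∀ w, w ≠ u → w ≠ v → Even (G.degIn B w) := by
    intro w hwu hwv
    by_cases hw : w ∈ G.support B
    · rw [hB, degIn_compEdges_of_mem hw]
      exact hDe w hwu hwv
    · rw [degIn_eq_zero_iff.2 hw]
      exact Even.zero
  have hBj : IsJoin B u v :=
    ⟨connOn_compEdges _ _, hBu, odd_degIn_of_odd_degIn huv hBe hBu, hBe⟩
  have hBK : B ⊆ K := (compEdges_subset _ _).trans Finset.sdiff_subset
  exact ⟨K \ B, B, Finset.sdiff_disjoint, Finset.sdiff_union_of_subset hBK,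
    IsJoin.sdiff hKe hBK hBj (connOn_sdiff_compEdges hK hRj.1 hR.1 hRK u), hBj⟩

theorem IsJoin.isPath_of_circuit {C R T : Finset G.E} {u v : G.V} (hC : G.IsCircuit C)
    (huv : u ≠ v) (hR : IsJoin R u v) (hT : IsJoin T u v) (hd : Disjoint R T)
    (hRT : R ∪ T = C) : G.IsPath R u v := by
  have hdeg : ∀ w ∈ G.support C, G.degIn R w + G.degIn T w = 2 := by
    intro w hw
    rw [← degIn_union hd, hRT]
    exact hC.2.2 w hw
  have hRC : R ⊆ C := hRT ▸ Finset.subset_union_left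
  obtain ⟨e, he, _⟩ := mem_support.1 hR.left_mem
  refine ⟨⟨e, he⟩, hR.1, huv, hR.left_mem, hR.right_mem, ?_, ?_, ?_⟩
  · have h1 := hdeg u (support_mono hRC hR.left_mem)
    have h2 := hR.2.1
    have h3 := hT.2.1
    grind
  · have h1 := hdeg v (support_mono hRC hR.right_mem)
    have h2 := hR.2.2.1
    have h3 := hT.2.2.1
    grind
  · intro w hw hwu hwv
    have h1 := hdeg w (support_mono hRC hw)
    have h2 := hR.2.2.2 w hwu hwv
    have h3 : G.degIn R w ≠ 0 := fun h => degIn_eq_zero_iff.1 h hw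
    grind

theorem IsCircuit.split {C : Finset G.E} (hC : G.IsCircuit C) {u v : G.V}
    (hu : u ∈ G.support C) (hv : v ∈ G.support C) (huv : u ≠ v) :
    ∃ P Q, Disjoint P Q ∧ P ∪ Q = C ∧ G.IsPath P u v ∧ G.IsPath Q v u ∧
      ∀ x ∈ G.support P, x ∈ G.support Q → x = u ∨ x = v := by
  obtain ⟨P, Q, hd, hPQ, hP, hQ⟩ := exists_join_split hC.2.1 hC.evenDeg hu hv huv
  have hP' := hP.isPath_of_circuit hC huv hQ hd hPQ
  have hQ' := hQ.isPath_of_circuit hC huv hP hd.symm (by rw [Finset.union_comm, hPQ])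
  refine ⟨P, Q, hd, hPQ, hP', hQ'.symm, ?_⟩
  intro x hxP hxQ
  by_contra! hx
  have h1 := hP'.2.2.2.2.2.2.2 x hxP hx.1 hx.2
  have h2 := hQ'.2.2.2.2.2.2.2 x hxQ hx.1 hx.2
  have h3 := hC.2.2 x (support_mono (hPQ ▸ Finset.subset_union_left) hxP)
  rw [← hPQ, degIn_union hd] at h3
  omega

theorem isCircuit_insert_path {P : Finset G.E} {u v : G.V} {e : G.E} (hP : G.IsPath P u v)
    (he : G.ends e = s(u, v)) (heP : e ∉ P) : G.IsCircuit ({e} ∪ P) := by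
  obtain ⟨h1, h2, h3, h4, h5, h6, h7, h8⟩ := hP
  have hs := support_singleton he
  refine ⟨h1.mono Finset.subset_union_right,
    (connOn_singleton e).union h2 (x := u) (by simp [hs]) h4, fun w hw => ?_⟩
  rw [degIn_union (by simpa using heP), degIn_singleton_of_ne he h3]
  by_cases hwu : w = u
  · subst hwu; simp [h6]
  by_cases hwv : w = v
  · subst hwv; simp [h7]
  rw [support_union, hs] at hw
  simp only [Finset.mem_union, Finset.mem_insert, Finset.mem_singleton, hwu, hwv,
    false_or] at hw
  simp [hwu, hwv, h8 w hw hwu hwv]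

theorem isCircuit_loop {e : G.E} {v : G.V} (he : G.ends e = s(v, v)) : G.IsCircuit {e} := by
  refine ⟨Finset.singleton_nonempty e, connOn_singleton e, fun w hw => ?_⟩
  rw [support_singleton he] at hw
  have : w = v := by simpa using hw
  rw [this, degIn_singleton_loop he]

theorem exists_isCircuit {S : Finset G.E} (hS : EvenDeg S) {v : G.V} (hv : v ∈ G.support S) :
    ∃ C ⊆ S, G.IsCircuit C ∧ v ∈ G.support C := by
  obtain ⟨e, he, hve⟩ := mem_support.1 hv
  obtain ⟨w, hew⟩ := hve
  by_cases hvw : v = w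
  · subst hvw
    refine ⟨{e}, by simpa using he, isCircuit_loop hew, ?_⟩
    simp [support_singleton hew]
  have hsub : {e} ⊆ S := by simpa using he
  have hd := degIn_sdiff (G := G) hsub
  have hde := degIn_singleton_of_ne hew hvw
  have hodd : Odd (G.degIn (S \ {e}) v) := by
    have h1 := hS v
    rw [← hd v, hde] at h1
    simp only [true_or, if_true] at h1
    grind
  set B := G.compEdges (S \ {e}) v with hB
  have hvB : v ∈ G.support B :=
    mem_support_compEdges (mem_support_of_odd hodd) Relation.ReflTransGen.refl
  have hwB : w ∈ G.support B := by
    refine mem_support_of_odd (odd_degIn_of_odd_degIn hvw ?_ ?_)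
    · intro x hxv hxw
      by_cases hx : x ∈ G.support B
      · rw [hB, degIn_compEdges_of_mem hx]
        have h1 := hS x
        rw [← hd x, hde] at h1
        simpa [hxv, hxw] using h1
      · rw [degIn_eq_zero_iff.2 hx]
        exact Even.zero
    · rw [hB, degIn_compEdges_of_mem hvB]
      exact hodd
  obtain ⟨P, hPB, hP⟩ := exists_isPath (connOn_compEdges (S \ {e}) v v hvB w hwB) hvw
  have hPS : P ⊆ S \ {e} := hPB.trans (compEdges_subset _ _)
  refine ⟨{e} ∪ P, Finset.union_subset hsub (hPS.trans Finset.sdiff_subset),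
    isCircuit_insert_path hP hew fun h => ?_, ?_⟩
  · simpa using hPS h
  · exact support_mono Finset.subset_union_right hP.left_mem

/-- A tadpole at `v`: an unbalanced circuit through `v`, or an unbalanced circuit together with
a path from `v` to it. -/
def IsTadpole (T : Finset G.E) (v : G.V) : Prop :=
  (G.IsUnbalancedCircuit T ∧ v ∈ G.support T) ∨
    ∃ C P u, G.IsUnbalancedCircuit C ∧ u ∈ G.support C ∧ G.IsPath P v u ∧
      (∀ x ∈ G.support P, x ∈ G.support C → x = u) ∧ T = C ∪ P

theorem IsPath.disjoint_of_left {P T : Finset G.E} {u v : G.V} (hP : G.IsPath P u v)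
    (h : ∀ x ∈ G.support P, x ∈ G.support T → x = u) : Disjoint P T := by
  refine disjoint_of_support_inter h ?_
  have := hP.2.2.2.2.2.1
  omega

theorem IsPath.disjoint_of_right {P T : Finset G.E} {u v : G.V} (hP : G.IsPath P u v)
    (h : ∀ x ∈ G.support P, x ∈ G.support T → x = v) : Disjoint P T :=
  hP.symm.disjoint_of_left h

theorem IsTadpole.extend {T R : Finset G.E} {u v : G.V} (hT : IsTadpole T v)
    (hR : G.IsPath R u v) (h : ∀ x ∈ G.support R, x ∈ G.support T → x = v) :
    IsTadpole (R ∪ T) u := by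
  rcases hT with hT | ⟨C, P, w, hC, hwC, hP, hPC, rfl⟩
  · exact Or.inr ⟨T, R, v, hT.1, hT.2, hR, h, Finset.union_comm _ _⟩
  · simp only [support_union, Finset.mem_union] at h
    refine Or.inr ⟨C, R ∪ P, w, hC, hwC, hR.append hP fun x hx hx' => h x hx (Or.inr hx'), ?_, ?_⟩
    · intro x hx hxC
      rw [support_union, Finset.mem_union] at hx
      rcases hx with hx | hx
      · have hxv := h x hx (Or.inl hxC)
        subst hxv
        exact hPC x hP.left_mem hxC
      · exact hPC x hx hxC
    · ext e
      simp only [Finset.mem_union]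
      tauto

theorem isSignedCircuit_of_path {C₁ C₂ P : Finset G.E} {u v : G.V}
    (h₁ : G.IsUnbalancedCircuit C₁) (h₂ : G.IsUnbalancedCircuit C₂)
    (h : Disjoint (G.support C₁) (G.support C₂)) (hP : G.IsPath P u v)
    (hu : u ∈ G.support C₁) (hv : v ∈ G.support C₂)
    (hPu : ∀ x ∈ G.support P, x ∈ G.support C₁ → x = u)
    (hPv : ∀ x ∈ G.support P, x ∈ G.support C₂ → x = v) :
    G.IsSignedCircuit (C₁ ∪ C₂ ∪ P) := by
  refine Or.inr (Or.inr ⟨C₁, C₂, P, u, v, h₁, h₂, h, hP, ?_, ?_, hP.disjoint_of_left hPu,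
    hP.disjoint_of_right hPv, rfl⟩)
  · ext x
    simp only [Finset.mem_inter, Finset.mem_singleton]
    exact ⟨fun hx => hPu x hx.1 hx.2, fun hx => hx ▸ ⟨hP.left_mem, hu⟩⟩
  · ext x
    simp only [Finset.mem_inter, Finset.mem_singleton]
    exact ⟨fun hx => hPv x hx.1 hx.2, fun hx => hx ▸ ⟨hP.right_mem, hv⟩⟩

theorem IsUnbalancedCircuit.union_tadpole {T C P : Finset G.E} {u v : G.V}
    (hT : G.IsUnbalancedCircuit T) (hv : v ∈ G.support T) (hC : G.IsUnbalancedCircuit C)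
    (hu : u ∈ G.support C) (hP : G.IsPath P v u)
    (hPC : ∀ x ∈ G.support P, x ∈ G.support C → x = u)
    (h : ∀ x ∈ G.support T, x ∈ G.support (C ∪ P) → x = v) :
    G.IsSignedCircuit (T ∪ (C ∪ P)) := by
  simp only [support_union, Finset.mem_union] at h
  rw [← Finset.union_assoc]
  refine isSignedCircuit_of_path hT hC ?_ hP hv hu (fun x hx hx' => h x hx' (Or.inr hx)) hPC
  rw [Finset.disjoint_left]
  intro x hx hx'
  have hxv := h x hx (Or.inl hx')
  subst hxv
  exact hP.ne (hPC x hP.left_mem hx')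

theorem IsTadpole.isSignedCircuit_union {T₁ T₂ : Finset G.E} {v : G.V} (h₁ : IsTadpole T₁ v)
    (h₂ : IsTadpole T₂ v) (h : ∀ x ∈ G.support T₁, x ∈ G.support T₂ → x = v)
    (hd : Disjoint T₁ T₂) : G.IsSignedCircuit (T₁ ∪ T₂) := by
  rcases h₁ with h₁ | ⟨C, P, u, hC, hu, hP, hPC, rfl⟩
  · rcases h₂ with h₂ | ⟨C', P', u', hC', hu', hP', hPC', rfl⟩
    · refine Or.inr (Or.inl ⟨T₁, T₂, h₁.1, h₂.1, hd, ?_, rfl⟩)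
      rw [Finset.card_eq_one]
      refine ⟨v, ?_⟩
      ext x
      simp only [Finset.mem_inter, Finset.mem_singleton]
      exact ⟨fun hx => h x hx.1 hx.2, fun hx => hx ▸ ⟨h₁.2, h₂.2⟩⟩
    · exact h₁.1.union_tadpole h₁.2 hC' hu' hP' hPC' h
  · rcases h₂ with h₂ | ⟨C', P', u', hC', hu', hP', hPC', rfl⟩
    · rw [Finset.union_comm]
      exact h₂.1.union_tadpole h₂.2 hC hu hP hPC fun x hx hx' => h x hx' hx
    · simp only [support_union, Finset.mem_union] at h
      have hPP := hP.symm.append hP' fun x hx hx' => h x (Or.inr hx) (Or.inr hx')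
      have hv : v ∉ G.support C := fun hvC => hP.ne (hPC v hP.left_mem hvC)
      have hv' : v ∉ G.support C' := fun hvC => hP'.ne (hPC' v hP'.left_mem hvC)
      have heq : C ∪ P ∪ (C' ∪ P') = C ∪ C' ∪ (P ∪ P') := by
        ext e
        simp only [Finset.mem_union]
        tauto
      rw [heq]
      refine isSignedCircuit_of_path hC hC' ?_ hPP hu hu' ?_ ?_
      · rw [Finset.disjoint_left]
        intro x hx hx'
        exact hv (h x (Or.inl hx) (Or.inl hx') ▸ hx)
      · intro x hx hxC
        rw [support_union, Finset.mem_union] at hx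
        rcases hx with hx | hx
        · exact hPC x hx hxC
        · exact absurd (h x (Or.inl hxC) (Or.inr hx) ▸ hxC) hv
      · intro x hx hxC
        rw [support_union, Finset.mem_union] at hx
        rcases hx with hx | hx
        · exact absurd (h x (Or.inr hx) (Or.inl hxC) ▸ hxC) hv'
        · exact hPC' x hx hxC

/-- The indicator function of an edge set. -/
def ind (S : Finset G.E) (e : G.E) : ℕ := if e ∈ S then 1 else 0

theorem ind_of_mem {S : Finset G.E} {e : G.E} (h : e ∈ S) : ind S e = 1 := if_pos h

theorem ind_of_notMem {S : Finset G.E} {e : G.E} (h : e ∉ S) : ind S e = 0 := if_neg h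

theorem ind_union {S T : Finset G.E} (h : Disjoint S T) (e : G.E) :
    ind (S ∪ T) e = ind S e + ind T e := by
  have h' : e ∈ S → e ∉ T := fun h1 => Finset.disjoint_left.1 h h1
  unfold ind
  by_cases h1 : e ∈ S <;> by_cases h2 : e ∈ T <;> simp_all

theorem coverCount_add (F F' : Multiset (Finset G.E)) (e : G.E) :
    G.coverCount (F + F') e = G.coverCount F e + G.coverCount F' e := by
  simp [coverCount]

theorem coverCount_singleton (S : Finset G.E) (e : G.E) :
    G.coverCount {S} e = ind S e := by
  unfold coverCount ind
  rw [Multiset.filter_singleton]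
  split_ifs <;> simp

theorem coverCount_zero (e : G.E) : G.coverCount 0 e = 0 := by
  simp [coverCount]

/-- Signed circuits and two tadpoles at `x` that together cover every edge of `K` twice. -/
def HasTadpoleCover (K : Finset G.E) (x : G.V) : Prop :=
  ∃ (F : Multiset (Finset G.E)) (T T' : Finset G.E), (∀ S ∈ F, G.IsSignedCircuit S) ∧
    IsTadpole T x ∧ IsTadpole T' x ∧
    ∀ e, G.coverCount F e + ind T e + ind T' e = 2 * ind K e

theorem subset_of_tadpole_cover {F : Multiset (Finset G.E)} {K T T' : Finset G.E}
    (h : ∀ e, G.coverCount F e + ind T e + ind T' e = 2 * ind K e) : T ⊆ K ∧ T' ⊆ K := by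
  constructor
  · intro e he
    by_contra hK
    have := h e
    rw [ind_of_mem he, ind_of_notMem hK] at this
    omega
  · intro e he
    by_contra hK
    have := h e
    rw [ind_of_mem he, ind_of_notMem hK] at this
    omega

theorem mem_support_of_forall {T A B : Finset G.E} {Y : Finset G.V} {K : G.V → Finset G.E}
    (h : ∀ e ∈ T, e ∈ A ∨ e ∈ B ∨ ∃ y ∈ Y, e ∈ K y) {x : G.V} (hx : x ∈ G.support T) :
    x ∈ G.support A ∨ x ∈ G.support B ∨ ∃ y ∈ Y, x ∈ G.support (K y) := by
  obtain ⟨e, he, hxe⟩ := mem_support.1 hx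
  rcases h e he with h | h | ⟨y, hy, h⟩
  · exact Or.inl (mem_support.2 ⟨e, h, hxe⟩)
  · exact Or.inr (Or.inl (mem_support.2 ⟨e, h, hxe⟩))
  · exact Or.inr (Or.inr ⟨y, hy, mem_support.2 ⟨e, h, hxe⟩⟩)

/-- Two tadpoles at the start of a path are carried along the path, being exchanged at each
attachment on the way; the second one is exchanged last. -/
theorem exists_thread (n : ℕ) {P : Finset G.E} {a w : G.V} (hP : G.IsPath P a w)
    {Y : Finset G.V} (hn : Y.card = n) {K : G.V → Finset G.E}
    (hY : ∀ y ∈ Y, y ∈ G.support P ∧ y ≠ a ∧ y ≠ w)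
    (hK : ∀ y ∈ Y, HasTadpoleCover (K y) y)
    (hKP : ∀ y ∈ Y, ∀ x ∈ G.support (K y), x ∈ G.support P → x = y)
    (hKd : ∀ y ∈ Y, Disjoint (K y) P)
    (hKK : ∀ y ∈ Y, ∀ z ∈ Y, y ≠ z → Disjoint (G.support (K y)) (G.support (K z)))
    {A B : Finset G.E} (hA : IsTadpole A a) (hB : IsTadpole B a)
    (hAP : ∀ x ∈ G.support A, x ∈ G.support P → x = a)
    (hBP : ∀ x ∈ G.support B, x ∈ G.support P → x = a)
    (hAK : ∀ y ∈ Y, Disjoint (G.support A) (G.support (K y)))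
    (hBK : ∀ y ∈ Y, Disjoint (G.support B) (G.support (K y))) :
    ∃ (F : Multiset (Finset G.E)) (A' B' : Finset G.E), (∀ S ∈ F, G.IsSignedCircuit S) ∧
      IsTadpole A' w ∧ IsTadpole B' w ∧
      (∀ e, G.coverCount F e + ind A' e + ind B' e =
        ind A e + ind B e + 2 * ind P e + 2 * ∑ y ∈ Y, ind (K y) e) ∧
      (∀ e ∈ A', e ∈ A ∪ B ∨ e ∈ P ∨ ∃ y ∈ Y, e ∈ K y) ∧
      (∀ e ∈ B', e ∈ B ∨ e ∈ P ∨ ∃ y ∈ Y, e ∈ K y) := by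
  induction n using Nat.strong_induction_on generalizing P a w Y A B with
  | _ n ih =>
  rcases Y.eq_empty_or_nonempty with rfl | ⟨y, hy⟩
  · refine ⟨0, P ∪ A, P ∪ B, by simp, hA.extend hP.symm fun x hx hx' => hAP x hx' hx,
      hB.extend hP.symm fun x hx hx' => hBP x hx' hx, ?_, ?_, ?_⟩
    · intro e
      rw [ind_union (hP.disjoint_of_left fun x hx hx' => hAP x hx' hx),
        ind_union (hP.disjoint_of_left fun x hx hx' => hBP x hx' hx), coverCount_zero]
      simp only [Finset.sum_empty]
      omega
    · intro e he
      simp only [Finset.mem_union] at he ⊢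
      tauto
    · intro e he
      simp only [Finset.mem_union] at he ⊢
      tauto
  obtain ⟨hyP, hya, hyw⟩ := hY y hy
  obtain ⟨P₁, P₂, hPd, hPP, hP₁, hP₂, hPi⟩ := hP.split hyP hya hyw
  have hP₁P : P₁ ⊆ P := hPP ▸ Finset.subset_union_left
  have hP₂P : P₂ ⊆ P := hPP ▸ Finset.subset_union_right
  have hs₁ := support_mono (G := G) hP₁P
  have hs₂ := support_mono (G := G) hP₂P
  obtain ⟨Fy, T, T', hFy, hT, hT', hcy⟩ := hK y hy
  obtain ⟨hTK, hTK'⟩ := subset_of_tadpole_cover hcy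
  have hsT := support_mono (G := G) hTK
  have hsT' := support_mono (G := G) hTK'
  set Y₁ := Y.filter fun z => z ∈ G.support P₁ ∧ z ≠ y with hY₁
  set Y₂ := Y.filter fun z => z ∈ G.support P₂ ∧ z ≠ y with hY₂
  have hm₁ : ∀ z, z ∈ Y₁ ↔ z ∈ Y ∧ z ∈ G.support P₁ ∧ z ≠ y := by simp [hY₁]
  have hm₂ : ∀ z, z ∈ Y₂ ↔ z ∈ Y ∧ z ∈ G.support P₂ ∧ z ≠ y := by simp [hY₂]
  have hd₁₂ : Disjoint Y₁ Y₂ := by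
    rw [Finset.disjoint_left]
    intro z hz hz'
    rw [hm₁] at hz
    rw [hm₂] at hz'
    exact hz.2.2 (hPi z hz.2.1 hz'.2.1)
  have hyn : y ∉ Y₁ ∪ Y₂ := by simp [hm₁, hm₂]
  have hYY : Y = insert y (Y₁ ∪ Y₂) := by
    ext z
    simp only [Finset.mem_insert, Finset.mem_union, hm₁, hm₂]
    constructor
    · intro hz
      have h := (hY z hz).1
      rw [← hPP, support_union, Finset.mem_union] at h
      tauto
    · rintro (rfl | h | h)
      · exact hy
      · exact h.1
      · exact h.1
  have hcard : Y.card = (Y₁.card + Y₂.card) + 1 := by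
    rw [hYY, Finset.card_insert_of_notMem hyn, Finset.card_union_of_disjoint hd₁₂]
  have hsub₁ : ∀ z ∈ Y₁, z ∈ Y := fun z hz => ((hm₁ z).1 hz).1
  have hsub₂ : ∀ z ∈ Y₂, z ∈ Y := fun z hz => ((hm₂ z).1 hz).1
  obtain ⟨F₁, A₁, B₁, hF₁, hA₁, hB₁, hc₁, hA₁s, hB₁s⟩ :=
    ih Y₁.card (by omega) hP₁ rfl
      (fun z hz => ⟨((hm₁ z).1 hz).2.1, (hY z (hsub₁ z hz)).2.1, ((hm₁ z).1 hz).2.2⟩)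
      (fun z hz => hK z (hsub₁ z hz))
      (fun z hz x hx hx' => hKP z (hsub₁ z hz) x hx (hs₁ hx'))
      (fun z hz => (hKd z (hsub₁ z hz)).mono_right hP₁P)
      (fun z hz z' hz' => hKK z (hsub₁ z hz) z' (hsub₁ z' hz'))
      hA hB (fun x hx hx' => hAP x hx (hs₁ hx')) (fun x hx hx' => hBP x hx (hs₁ hx'))
      (fun z hz => hAK z (hsub₁ z hz)) (fun z hz => hBK z (hsub₁ z hz))
  have hB₁P₂ : ∀ x ∈ G.support B₁, x ∈ G.support P₂ → x = y := by
    intro x hx hx'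
    rcases mem_support_of_forall hB₁s hx with h | h | ⟨z, hz, h⟩
    · have := hBP x h (hs₂ hx')
      subst this
      exact hPi x hP₁.left_mem hx'
    · exact hPi x h hx'
    · have := hKP z (hsub₁ z hz) x h (hs₂ hx')
      subst this
      exact hPi x ((hm₁ x).1 hz).2.1 hx'
  have hB₁K : ∀ z ∈ Y₂, Disjoint (G.support B₁) (G.support (K z)) := by
    intro z hz
    rw [Finset.disjoint_left]
    intro x hx hx'
    rcases mem_support_of_forall hB₁s hx with h | h | ⟨z', hz', h⟩
    · exact Finset.disjoint_left.1 (hBK z (hsub₂ z hz)) h hx'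
    · have := hKP z (hsub₂ z hz) x hx' (hs₁ h)
      subst this
      exact ((hm₂ x).1 hz).2.2 (hPi x h ((hm₂ x).1 hz).2.1)
    · refine Finset.disjoint_left.1 (hKK z' (hsub₁ z' hz') z (hsub₂ z hz) ?_) h hx'
      rintro rfl
      exact Finset.disjoint_left.1 hd₁₂ hz' hz
  obtain ⟨F₂, A₂, B₂, hF₂, hA₂, hB₂, hc₂, hA₂s, hB₂s⟩ :=
    ih Y₂.card (by omega) hP₂ rfl
      (fun z hz => ⟨((hm₂ z).1 hz).2.1, ((hm₂ z).1 hz).2.2, (hY z (hsub₂ z hz)).2.2⟩)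
      (fun z hz => hK z (hsub₂ z hz))
      (fun z hz x hx hx' => hKP z (hsub₂ z hz) x hx (hs₂ hx'))
      (fun z hz => (hKd z (hsub₂ z hz)).mono_right hP₂P)
      (fun z hz z' hz' => hKK z (hsub₂ z hz) z' (hsub₂ z' hz'))
      hB₁ hT' hB₁P₂ (fun x hx hx' => hKP y hy x (hsT' hx) (hs₂ hx')) hB₁K
      (fun z hz => (hKK y hy z (hsub₂ z hz) (Ne.symm ((hm₂ z).1 hz).2.2)).mono_left hsT')
  have hA₁T : ∀ x ∈ G.support A₁, x ∈ G.support T → x = y := by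
    intro x hx hx'
    rcases mem_support_of_forall hA₁s hx with h | h | ⟨z, hz, h⟩
    · rw [support_union, Finset.mem_union] at h
      rcases h with h | h
      · exact absurd (hsT hx') (Finset.disjoint_left.1 (hAK y hy) h)
      · exact absurd (hsT hx') (Finset.disjoint_left.1 (hBK y hy) h)
    · exact hKP y hy x (hsT hx') (hs₁ h)
    · exact absurd (hsT hx')
        (Finset.disjoint_left.1 (hKK z (hsub₁ z hz) y hy ((hm₁ z).1 hz).2.2) h)
  have hA₁Td : Disjoint A₁ T := by
    rw [Finset.disjoint_left]
    intro e he he'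
    rcases hA₁s e he with h | h | ⟨z, hz, h⟩
    · rcases Finset.mem_union.1 h with h | h
      · exact Finset.disjoint_left.1 (disjoint_of_disjoint_support (hAK y hy)) h (hTK he')
      · exact Finset.disjoint_left.1 (disjoint_of_disjoint_support (hBK y hy)) h (hTK he')
    · exact Finset.disjoint_left.1 (hKd y hy) (hTK he') (hP₁P h)
    · exact Finset.disjoint_left.1 (disjoint_of_disjoint_support
        (hKK z (hsub₁ z hz) y hy ((hm₁ z).1 hz).2.2)) h (hTK he')
  refine ⟨F₁ + F₂ + Fy + {A₁ ∪ T}, A₂, B₂, ?_, hA₂, hB₂, ?_, ?_, ?_⟩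
  · intro S hS
    simp only [Multiset.mem_add, Multiset.mem_singleton] at hS
    rcases hS with ((hS | hS) | hS) | rfl
    · exact hF₁ S hS
    · exact hF₂ S hS
    · exact hFy S hS
    · exact hA₁.isSignedCircuit_union hT hA₁T hA₁Td
  · intro e
    have h1 := hc₁ e
    have h2 := hc₂ e
    have h3 := hcy e
    have h4 : ind P e = ind P₁ e + ind P₂ e := by rw [← hPP, ind_union hPd]
    have h5 : ∑ z ∈ Y, ind (K z) e =
        ind (K y) e + (∑ z ∈ Y₁, ind (K z) e + ∑ z ∈ Y₂, ind (K z) e) := by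
      rw [hYY, Finset.sum_insert hyn, Finset.sum_union hd₁₂]
    rw [coverCount_add, coverCount_add, coverCount_add, coverCount_singleton,
      ind_union hA₁Td, h4, h5]
    omega
  · intro e he
    rcases hA₂s e he with h | h | ⟨z, hz, h⟩
    · rcases Finset.mem_union.1 h with h | h
      · rcases hB₁s e h with h | h | ⟨z, hz, h⟩
        · exact Or.inl (Finset.mem_union_right _ h)
        · exact Or.inr (Or.inl (hP₁P h))
        · exact Or.inr (Or.inr ⟨z, hsub₁ z hz, h⟩)
      · exact Or.inr (Or.inr ⟨y, hy, hTK' h⟩)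
    · exact Or.inr (Or.inl (hP₂P h))
    · exact Or.inr (Or.inr ⟨z, hsub₂ z hz, h⟩)
  · intro e he
    rcases hB₂s e he with h | h | ⟨z, hz, h⟩
    · exact Or.inr (Or.inr ⟨y, hy, hTK' h⟩)
    · exact Or.inr (Or.inl (hP₂P h))
    · exact Or.inr (Or.inr ⟨z, hsub₂ z hz, h⟩)

/-- A path meeting a set of vertices can be split at the first one of them. -/
theorem IsPath.split_first {P : Finset G.E} {a w : G.V} (hP : G.IsPath P a w)
    {Y : Finset G.V} (hYn : Y.Nonempty) (hY : ∀ y ∈ Y, y ∈ G.support P ∧ y ≠ a ∧ y ≠ w) :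
    ∃ y ∈ Y, ∃ P₁ P₂, Disjoint P₁ P₂ ∧ P₁ ∪ P₂ = P ∧ G.IsPath P₁ a y ∧ G.IsPath P₂ y w ∧
      (∀ x ∈ G.support P₁, x ∈ G.support P₂ → x = y) ∧
      ∀ z ∈ Y, z ∈ G.support P₁ → z = y := by
  induction hn : Y.card using Nat.strong_induction_on generalizing P w Y with
  | _ n ih =>
    obtain ⟨y, hy⟩ := hYn
    obtain ⟨hyP, hya, hyw⟩ := hY y hy
    obtain ⟨P₁, P₂, hd, hPP, hP₁, hP₂, hi⟩ := hP.split hyP hya hyw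
    by_cases hz : ∃ z ∈ Y, z ∈ G.support P₁ ∧ z ≠ y
    · obtain ⟨z, hz, hzP, hzy⟩ := hz
      set Y' := Y.filter fun z => z ∈ G.support P₁ ∧ z ≠ y with hY'
      have hm : ∀ z, z ∈ Y' ↔ z ∈ Y ∧ z ∈ G.support P₁ ∧ z ≠ y := by simp [hY']
      have hlt : Y'.card < n := by
        rw [← hn]
        exact Finset.card_lt_card (Finset.filter_ssubset.2 ⟨y, hy, by simp⟩)
      obtain ⟨y', hy', Q₁, Q₂, hQd, hQQ, hQ₁, hQ₂, hQi, hQf⟩ := ih _ hlt hP₁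
        (Y := Y') ⟨z, (hm z).2 ⟨hz, hzP, hzy⟩⟩
        (fun x hx => ⟨((hm x).1 hx).2.1, (hY x ((hm x).1 hx).1).2.1, ((hm x).1 hx).2.2⟩) rfl
      have hs₁ : G.support Q₁ ⊆ G.support P₁ :=
        support_mono (hQQ ▸ Finset.subset_union_left)
      have hs₂ : G.support Q₂ ⊆ G.support P₁ :=
        support_mono (hQQ ▸ Finset.subset_union_right)
      refine ⟨y', ((hm y').1 hy').1, Q₁, Q₂ ∪ P₂, ?_, ?_, hQ₁,
        hQ₂.append hP₂ fun x hx hx' => hi x (hs₂ hx) hx', ?_, ?_⟩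
      · rw [Finset.disjoint_union_right]
        exact ⟨hQd, hd.mono_left (hQQ ▸ Finset.subset_union_left)⟩
      · rw [← Finset.union_assoc, hQQ, hPP]
      · intro x hx hx'
        rw [support_union, Finset.mem_union] at hx'
        rcases hx' with hx' | hx'
        · exact hQi x hx hx'
        · have := hi x (hs₁ hx) hx'
          subst this
          exact hQi x hx hQ₂.right_mem
      · intro x hx hxQ
        by_cases hxy : x = y
        · subst hxy
          exact hQi x hxQ hQ₂.right_mem
        · exact hQf x ((hm x).2 ⟨hx, hs₁ hxQ, hxy⟩) hxQ
    · push Not at hz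
      exact ⟨y, hy, P₁, P₂, hd, hPP, hP₁, hP₂, hi, hz⟩

theorem IsCircuit.split_first {C : Finset G.E} (hC : G.IsCircuit C) {v : G.V}
    (hv : v ∈ G.support C) {X : Finset G.V} (hXn : X.Nonempty)
    (hX : ∀ x ∈ X, x ∈ G.support C ∧ x ≠ v) :
    ∃ x ∈ X, ∃ P Q, Disjoint P Q ∧ P ∪ Q = C ∧ G.IsPath P v x ∧ G.IsPath Q x v ∧
      (∀ z ∈ G.support P, z ∈ G.support Q → z = v ∨ z = x) ∧
      ∀ z ∈ X, z ∈ G.support P → z = x := by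
  obtain ⟨x, hx⟩ := hXn
  obtain ⟨P, Q, hd, hPQ, hP, hQ, hi⟩ := hC.split hv (hX x hx).1 (hX x hx).2.symm
  by_cases hz : ∃ z ∈ X, z ∈ G.support P ∧ z ≠ x
  · obtain ⟨z, hz, hzP, hzx⟩ := hz
    obtain ⟨y, hy, P₁, P₂, hd', hPP, hP₁, hP₂, hi', hf⟩ :=
      hP.split_first (Y := X.filter fun z => z ∈ G.support P ∧ z ≠ x)
        ⟨z, by simp [hz, hzP, hzx]⟩
        (fun y hy => by
          simp only [Finset.mem_filter] at hy
          exact ⟨hy.2.1, (hX y hy.1).2, hy.2.2⟩)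
    simp only [Finset.mem_filter] at hy hf
    have hs₁ : G.support P₁ ⊆ G.support P := support_mono (hPP ▸ Finset.subset_union_left)
    have hs₂ : G.support P₂ ⊆ G.support P := support_mono (hPP ▸ Finset.subset_union_right)
    have hxP₁ : x ∉ G.support P₁ := fun h => hy.2.2 (hi' x h hP₂.right_mem).symm
    have hvP₂ : v ∉ G.support P₂ := fun h => hP₁.ne (hi' v hP₁.left_mem h)
    refine ⟨y, hy.1, P₁, P₂ ∪ Q, ?_, ?_, hP₁, hP₂.append hQ ?_, ?_, ?_⟩
    · rw [Finset.disjoint_union_right]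
      exact ⟨hd', hd.mono_left (hPP ▸ Finset.subset_union_left)⟩
    · rw [← Finset.union_assoc, hPP, hPQ]
    · intro u hu hu'
      rcases hi u (hs₂ hu) hu' with rfl | rfl
      · exact absurd hu hvP₂
      · rfl
    · intro u hu hu'
      rw [support_union, Finset.mem_union] at hu'
      rcases hu' with hu' | hu'
      · exact Or.inr (hi' u hu hu')
      · rcases hi u (hs₁ hu) hu' with rfl | rfl
        · exact Or.inl rfl
        · exact absurd hu hxP₁
    · intro u hu hu'
      refine hf u ⟨hu, hs₁ hu', ?_⟩ hu'
      rintro rfl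
      exact hxP₁ hu'
  · push Not at hz
    exact ⟨x, hx, P, Q, hd, hPQ, hP, hQ, hi, hz⟩

/-- A circuit with at least two attachments besides the base vertex. -/
theorem exists_circuit_cover_of_two_le {C : Finset G.E} (hC : G.IsCircuit C) {v : G.V}
    (hv : v ∈ G.support C) {X : Finset G.V} (hX2 : 2 ≤ X.card) {K : G.V → Finset G.E}
    (hX : ∀ x ∈ X, x ∈ G.support C ∧ x ≠ v)
    (hK : ∀ x ∈ X, HasTadpoleCover (K x) x)
    (hKC : ∀ x ∈ X, ∀ z ∈ G.support (K x), z ∈ G.support C → z = x)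
    (hKd : ∀ x ∈ X, Disjoint (K x) C)
    (hKK : ∀ x ∈ X, ∀ z ∈ X, x ≠ z → Disjoint (G.support (K x)) (G.support (K z))) :
    ∃ (F : Multiset (Finset G.E)) (T T' : Finset G.E), (∀ S ∈ F, G.IsSignedCircuit S) ∧
      IsTadpole T v ∧ IsTadpole T' v ∧
      ∀ e, G.coverCount F e + ind T e + ind T' e =
        2 * (ind C e + ∑ x ∈ X, ind (K x) e) := by
  obtain ⟨x₁, hx₁, P₀, R, hd₀, hC₀, hP₀, hR, hi₀, hf₀⟩ :=
    hC.split_first hv (Finset.card_pos.1 (by omega)) hX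
  have hcard : (X.erase x₁).card + 1 = X.card := Finset.card_erase_add_one hx₁
  have hs₀ : G.support P₀ ⊆ G.support C := support_mono (hC₀ ▸ Finset.subset_union_left)
  have hsR : G.support R ⊆ G.support C := support_mono (hC₀ ▸ Finset.subset_union_right)
  have hXR : ∀ x ∈ X.erase x₁, x ∈ G.support R ∧ x ≠ x₁ ∧ x ≠ v := by
    intro x hx
    rw [Finset.mem_erase] at hx
    have h := (hX x hx.2).1
    rw [← hC₀, support_union, Finset.mem_union] at h
    exact ⟨h.resolve_left fun h => hx.1 (hf₀ x hx.2 h), hx.1, (hX x hx.2).2⟩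
  obtain ⟨x₂, hx₂, P₁, P, hd₁, hR₁, hP₁, hP, hi₁, hf₁⟩ :=
    hR.split_first (Finset.card_pos.1 (by omega)) hXR
  obtain ⟨hx₂₁, hx₂⟩ := Finset.mem_erase.1 hx₂
  have hs₁R : G.support P₁ ⊆ G.support R := support_mono (hR₁ ▸ Finset.subset_union_left)
  have hsPR : G.support P ⊆ G.support R := support_mono (hR₁ ▸ Finset.subset_union_right)
  have hs₁ := hs₁R.trans hsR
  have hsP := hsPR.trans hsR
  have hPC : P ⊆ C := by
    rw [← hC₀, ← hR₁]
    exact Finset.subset_union_right.trans Finset.subset_union_right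
  have hv₁ : v ∉ G.support P₁ := fun h => hP.ne (hi₁ v h hP.right_mem).symm
  have hx₂₀ : x₂ ∉ G.support P₀ := fun h => hx₂₁ (hf₀ x₂ hx₂ h)
  have hx₁P : x₁ ∉ G.support P := fun h => hP₁.ne (hi₁ x₁ hP₁.left_mem h)
  obtain ⟨F₁, T₁, T₁', hF₁, hT₁, hT₁', hc₁⟩ := hK x₁ hx₁
  obtain ⟨F₂, T₂, T₂', hF₂, hT₂, hT₂', hc₂⟩ := hK x₂ hx₂
  have hsT₁ := support_mono (G := G) (subset_of_tadpole_cover hc₁).1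
  have hsT₁' := support_mono (G := G) (subset_of_tadpole_cover hc₁).2
  have hsT₂ := support_mono (G := G) (subset_of_tadpole_cover hc₂).1
  have hsT₂' := support_mono (G := G) (subset_of_tadpole_cover hc₂).2
  have hK₁₂ := Finset.disjoint_left.1 (hKK x₁ hx₁ x₂ hx₂ hx₂₁.symm)
  have hi₁T₂ : ∀ z ∈ G.support P₁, z ∈ G.support T₂ → z = x₂ := fun z hz hz' =>
    hKC x₂ hx₂ z (hsT₂ hz') (hs₁ hz)
  have hi₀T₂ : ∀ z ∈ G.support P₀, z ∈ G.support (P₁ ∪ T₂) → z = x₁ := by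
    intro z hz hz'
    rw [support_union, Finset.mem_union] at hz'
    rcases hz' with hz' | hz'
    · rcases hi₀ z hz (hs₁R hz') with rfl | rfl
      · exact absurd hz' hv₁
      · rfl
    · have := hKC x₂ hx₂ z (hsT₂ hz') (hs₀ hz)
      subst this
      exact absurd hz hx₂₀
  have hout : IsTadpole (P₀ ∪ (P₁ ∪ T₂)) v := (hT₂.extend hP₁ hi₁T₂).extend hP₀ hi₀T₂
  have hi₁T₁ : ∀ z ∈ G.support P₁, z ∈ G.support T₁ → z = x₁ := fun z hz hz' =>
    hKC x₁ hx₁ z (hsT₁ hz') (hs₁ hz)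
  have hA : IsTadpole (P₁ ∪ T₁) x₂ := hT₁.extend hP₁.symm hi₁T₁
  set Y := (X.erase x₁).erase x₂ with hYdef
  have hm : ∀ y, y ∈ Y ↔ y ≠ x₂ ∧ y ≠ x₁ ∧ y ∈ X := by simp [hYdef]
  have hYX : ∀ y ∈ Y, y ∈ X := fun y hy => ((hm y).1 hy).2.2
  obtain ⟨F, A, B, hF, hA', hB', hc, -, hBs⟩ :=
    exists_thread Y.card hP (Y := Y) rfl (K := K)
      (fun y hy => by
        obtain ⟨h2, h1, hyX⟩ := (hm y).1 hy
        have h := hXR y (Finset.mem_erase.2 ⟨h1, hyX⟩)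
        have h' := h.1
        rw [← hR₁, support_union, Finset.mem_union] at h'
        exact ⟨h'.resolve_left fun h' => h2 (hf₁ y (Finset.mem_erase.2 ⟨h1, hyX⟩) h'),
          h2, h.2.2⟩)
      (fun y hy => hK y (hYX y hy))
      (fun y hy z hz hz' => hKC y (hYX y hy) z hz (hsP hz'))
      (fun y hy => (hKd y (hYX y hy)).mono_right hPC)
      (fun y hy z hz => hKK y (hYX y hy) z (hYX z hz))
      hA hT₂'
      (fun z hz hz' => by
        rw [support_union, Finset.mem_union] at hz
        rcases hz with hz | hz
        · exact hi₁ z hz hz'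
        · have := hKC x₁ hx₁ z (hsT₁ hz) (hsP hz')
          subst this
          exact absurd hz' hx₁P)
      (fun z hz hz' => hKC x₂ hx₂ z (hsT₂' hz) (hsP hz'))
      (fun y hy => by
        obtain ⟨h2, h1, hyX⟩ := (hm y).1 hy
        rw [support_union, Finset.disjoint_union_left]
        refine ⟨?_, (hKK x₁ hx₁ y hyX h1.symm).mono_left hsT₁⟩
        rw [Finset.disjoint_left]
        intro z hz hz'
        have := hKC y hyX z hz' (hs₁ hz)
        subst this
        exact h2 (hf₁ z (Finset.mem_erase.2 ⟨h1, hyX⟩) hz))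
      (fun y hy => (hKK x₂ hx₂ y (hYX y hy) ((hm y).1 hy).1.symm).mono_left hsT₂')
  have hi₀T₁ : ∀ z ∈ G.support P₀, z ∈ G.support T₁' → z = x₁ := fun z hz hz' =>
    hKC x₁ hx₁ z (hsT₁' hz') (hs₀ hz)
  have hD : IsTadpole (P₀ ∪ T₁') v := hT₁'.extend hP₀ hi₀T₁
  have hd₀T₁ : Disjoint P₀ T₁' := hP₀.disjoint_of_right hi₀T₁
  have hDB : ∀ z ∈ G.support (P₀ ∪ T₁'), z ∈ G.support B → z = v := by
    intro z hz hz'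
    rw [support_union, Finset.mem_union] at hz
    rcases mem_support_of_forall hBs hz' with h | h | ⟨y, hy, h⟩
    · rcases hz with hz | hz
      · have := hKC x₂ hx₂ z (hsT₂' h) (hs₀ hz)
        subst this
        exact absurd hz hx₂₀
      · exact absurd (hsT₂' h) (hK₁₂ (hsT₁' hz))
    · rcases hz with hz | hz
      · rcases hi₀ z hz (hsPR h) with rfl | rfl
        · rfl
        · exact absurd h hx₁P
      · have := hKC x₁ hx₁ z (hsT₁' hz) (hsP h)
        subst this
        exact absurd h hx₁P
    · obtain ⟨h2, h1, hyX⟩ := (hm y).1 hy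
      rcases hz with hz | hz
      · have := hKC y hyX z h (hs₀ hz)
        subst this
        exact absurd (hf₀ z hyX hz) h1
      · exact absurd h (Finset.disjoint_left.1 (hKK x₁ hx₁ y hyX h1.symm) (hsT₁' hz))
  have hDBd : Disjoint (P₀ ∪ T₁') B := by
    refine disjoint_of_support_inter hDB ?_
    have h1 : G.degIn P₀ v = 1 := hP₀.2.2.2.2.2.1
    have h2 : G.degIn T₁' v = 0 := degIn_eq_zero_iff.2 fun h =>
      (hX x₁ hx₁).2 (hKC x₁ hx₁ v (hsT₁' h) hv).symm
    rw [degIn_union hd₀T₁]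
    omega
  refine ⟨F + F₁ + F₂ + {P₀ ∪ T₁' ∪ B}, P₀ ∪ (P₁ ∪ T₂), A, ?_, hout, hA', ?_⟩
  · intro S hS
    simp only [Multiset.mem_add, Multiset.mem_singleton] at hS
    rcases hS with ((hS | hS) | hS) | rfl
    · exact hF S hS
    · exact hF₁ S hS
    · exact hF₂ S hS
    · exact hD.isSignedCircuit_union hB' hDB hDBd
  · intro e
    have e1 := hc e
    have e2 := hc₁ e
    have e3 := hc₂ e
    have e4 : ind C e = ind P₀ e + (ind P₁ e + ind P e) := by
      rw [← hC₀, ← hR₁, ind_union (by rwa [hR₁]), ind_union hd₁]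
    have e5 : ∑ x ∈ X, ind (K x) e =
        ind (K x₁) e + (ind (K x₂) e + ∑ y ∈ Y, ind (K y) e) := by
      rw [hYdef, Finset.add_sum_erase _ (fun x => ind (K x) e) (Finset.mem_erase.2 ⟨hx₂₁, hx₂⟩),
        Finset.add_sum_erase _ (fun x => ind (K x) e) hx₁]
    rw [coverCount_add, coverCount_add, coverCount_add, coverCount_singleton,
      ind_union hDBd, ind_union hd₀T₁, ind_union (hP₀.disjoint_of_right hi₀T₂),
      ind_union (hP₁.disjoint_of_right hi₁T₂), e4, e5]
    rw [ind_union (hP₁.disjoint_of_left hi₁T₁)] at e1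
    omega

/-- A circuit with attachments, seen from a base vertex without attachment. -/
theorem exists_circuit_cover {C : Finset G.E} (hC : G.IsCircuit C) {v : G.V}
    (hv : v ∈ G.support C) {X : Finset G.V} {K : G.V → Finset G.E}
    (hX : ∀ x ∈ X, x ∈ G.support C ∧ x ≠ v)
    (hK : ∀ x ∈ X, HasTadpoleCover (K x) x)
    (hKC : ∀ x ∈ X, ∀ z ∈ G.support (K x), z ∈ G.support C → z = x)
    (hKd : ∀ x ∈ X, Disjoint (K x) C)
    (hKK : ∀ x ∈ X, ∀ z ∈ X, x ≠ z → Disjoint (G.support (K x)) (G.support (K z)))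
    (h0 : X = ∅ → ¬ Even (G.negEdges C).card)
    (h1 : ∀ x, X = {x} → Even (G.negEdges C).card) :
    ∃ (F : Multiset (Finset G.E)) (T T' : Finset G.E), (∀ S ∈ F, G.IsSignedCircuit S) ∧
      IsTadpole T v ∧ IsTadpole T' v ∧
      ∀ e, G.coverCount F e + ind T e + ind T' e =
        2 * (ind C e + ∑ x ∈ X, ind (K x) e) := by
  by_cases hX2 : 2 ≤ X.card
  · exact exists_circuit_cover_of_two_le hC hv hX2 hX hK hKC hKd hKK
  by_cases hX0 : X = ∅
  · subst hX0
    have hT : IsTadpole C v := Or.inl ⟨⟨hC, h0 rfl⟩, hv⟩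
    refine ⟨0, C, C, by simp, hT, hT, fun e => ?_⟩
    rw [coverCount_zero, Finset.sum_empty]
    omega
  have hX1 : X.card = 1 := by
    have := Finset.card_pos.2 (Finset.nonempty_iff_ne_empty.2 hX0)
    omega
  obtain ⟨x, rfl⟩ := Finset.card_eq_one.1 hX1
  have hx := Finset.mem_singleton_self x
  obtain ⟨P, Q, hd, hPQ, hP, hQ, -⟩ := hC.split hv (hX x hx).1 (hX x hx).2.symm
  obtain ⟨F, T, T', hF, hT, hT', hc⟩ := hK x hx
  have hsT := support_mono (G := G) (subset_of_tadpole_cover hc).1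
  have hsT' := support_mono (G := G) (subset_of_tadpole_cover hc).2
  have hPT : ∀ z ∈ G.support P, z ∈ G.support T → z = x := fun z hz hz' =>
    hKC x hx z (hsT hz') (support_mono (hPQ ▸ Finset.subset_union_left) hz)
  have hQT : ∀ z ∈ G.support Q, z ∈ G.support T' → z = x := fun z hz hz' =>
    hKC x hx z (hsT' hz') (support_mono (hPQ ▸ Finset.subset_union_right) hz)
  refine ⟨F + {C}, P ∪ T, Q ∪ T', ?_, hT.extend hP hPT, hT'.extend hQ.symm hQT, fun e => ?_⟩
  · intro S hS
    simp only [Multiset.mem_add, Multiset.mem_singleton] at hS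
    rcases hS with hS | rfl
    · exact hF S hS
    · exact Or.inl ⟨hC, h1 x rfl⟩
  · have e1 := hc e
    have e2 : ind C e = ind P e + ind Q e := by rw [← hPQ, ind_union hd]
    rw [coverCount_add, coverCount_singleton, ind_union (hP.disjoint_of_right hPT),
      ind_union (hQ.disjoint_of_left hQT), Finset.sum_singleton, e2]
    omega

/-- `S` decomposes into two nonempty connected even subgraphs, the first with an even number of
negative edges and the second through `v`. -/
def Splits (S : Finset G.E) (v : G.V) : Prop :=
  ∃ A B, Disjoint A B ∧ A ∪ B = S ∧ A.Nonempty ∧ B.Nonempty ∧ G.ConnOn A ∧ G.ConnOn B ∧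
    EvenDeg A ∧ EvenDeg B ∧ Even (G.negEdges A).card ∧ v ∈ G.support B

/-- The edges of `W` in components of `W` meeting `Q`. -/
def attached (W Q : Finset G.E) : Finset G.E :=
  W.filter fun e => ∃ x ∈ G.ends e, ∃ q ∈ G.support Q, G.Reach W x q

theorem attached_subset (W Q : Finset G.E) : attached W Q ⊆ W := Finset.filter_subset _ _

theorem reach_of_mem_support_attached {W Q : Finset G.E} {u : G.V}
    (hu : u ∈ G.support (attached W Q)) : ∃ q ∈ G.support Q, G.Reach W u q := by
  obtain ⟨e, he, hue⟩ := mem_support.1 hu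
  simp only [attached, Finset.mem_filter] at he
  obtain ⟨heW, x, hx, q, hq, hr⟩ := he
  exact ⟨q, hq, (reach_of_mem_ends heW hue hx).trans hr⟩

theorem notMem_support_of_mem_sdiff_attached {W Q : Finset G.E} {u : G.V}
    (hu : u ∈ G.support (W \ attached W Q)) :
    u ∉ G.support Q ∧ u ∉ G.support (attached W Q) := by
  obtain ⟨e, he, hue⟩ := mem_support.1 hu
  rw [Finset.mem_sdiff] at he
  have key : ∀ q ∈ G.support Q, ¬ G.Reach W u q := fun q hq hr =>
    he.2 (by simp only [attached, Finset.mem_filter]; exact ⟨he.1, u, hue, q, hq, hr⟩)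
  refine ⟨fun h => key u h Relation.ReflTransGen.refl, fun h => ?_⟩
  obtain ⟨q, hq, hr⟩ := reach_of_mem_support_attached h
  exact key q hq hr

theorem evenDeg_attached {W : Finset G.E} (hW : EvenDeg W) (Q : Finset G.E) :
    EvenDeg (attached W Q) := by
  intro u
  have h := degIn_sdiff (attached_subset W Q) u
  by_cases hu : u ∈ G.support (attached W Q)
  · rw [degIn_eq_zero_iff.2 fun h' => (notMem_support_of_mem_sdiff_attached h').2 hu,
      zero_add] at h
    rw [h]
    exact hW u
  · rw [degIn_eq_zero_iff.2 hu]
    simp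

theorem ConnOn.union_attached {Q : Finset G.E} (hQ : G.ConnOn Q) (W : Finset G.E) :
    G.ConnOn (Q ∪ attached W Q) := by
  have key : ∀ u ∈ G.support (Q ∪ attached W Q),
      ∃ q ∈ G.support Q, G.Reach (Q ∪ attached W Q) u q := by
    intro u hu
    rw [support_union, Finset.mem_union] at hu
    rcases hu with hu | hu
    · exact ⟨u, hu, Relation.ReflTransGen.refl⟩
    · obtain ⟨q, hq, hr⟩ := reach_of_mem_support_attached hu
      refine ⟨q, hq, (reach_mono ?_ (reach_compEdges hr.symm)).symm⟩
      intro e he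
      simp only [compEdges, Finset.mem_filter] at he
      obtain ⟨heW, y, hy, hqy⟩ := he
      refine Finset.mem_union_right _ ?_
      simp only [attached, Finset.mem_filter]
      exact ⟨heW, y, hy, q, hq, hqy.symm⟩
  intro u hu v hv
  obtain ⟨p, hp, hr⟩ := key u hu
  obtain ⟨q, hq, hr'⟩ := key v hv
  exact (hr.trans (reach_mono Finset.subset_union_left (hQ p hp q hq))).trans hr'.symm

theorem splits_of_joins {S P Q R R' W : Finset G.E} {x w v : G.V} (hS : G.ConnOn S)
    (hSe : EvenDeg S) (hP : IsJoin P x w) (hQ : IsJoin Q x w) (hR : IsJoin R x w)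
    (hR' : IsJoin R' x w) (hW : EvenDeg W) (hPQ : Disjoint P Q) (hPR' : Disjoint P R')
    (hQR : Disjoint Q R) (hQR' : Disjoint Q R') (hRR' : Disjoint R R')
    (hWP : Disjoint W P) (hWQ : Disjoint W Q)
    (hWR : Disjoint (G.support W) (G.support R)) (hWR' : Disjoint (G.support W) (G.support R'))
    (hSu : S = (P ∪ R) ∪ (Q ∪ R') ∪ W) (hv : v ∈ G.support Q)
    (he : Even (G.negEdges (P ∪ R ∪ (W \ attached W Q))).card) : Splits S v := by
  have hsub := attached_subset W Q
  have hWRe := disjoint_of_disjoint_support hWR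
  have hWRe' := disjoint_of_disjoint_support hWR'
  have hdisj : Disjoint (P ∪ R ∪ (W \ attached W Q)) (Q ∪ R' ∪ attached W Q) := by
    rw [Finset.disjoint_left] at *
    intro e
    simp only [Finset.mem_union, Finset.mem_sdiff]
    have := @hsub e
    grind
  have hunion : P ∪ R ∪ (W \ attached W Q) ∪ (Q ∪ R' ∪ attached W Q) = S := by
    rw [hSu]
    ext e
    simp only [Finset.mem_union, Finset.mem_sdiff]
    have := @hsub e
    tauto
  have hBe : EvenDeg (Q ∪ R' ∪ attached W Q) := by
    intro u
    rw [degIn_union]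
    · exact (hQ.evenDeg_union hR' hQR' u).add (evenDeg_attached hW Q u)
    · rw [Finset.disjoint_union_left]
      exact ⟨(Finset.disjoint_of_subset_left hsub hWQ).symm,
        (Finset.disjoint_of_subset_left hsub hWRe').symm⟩
  have hAS : S \ (Q ∪ R' ∪ attached W Q) = P ∪ R ∪ (W \ attached W Q) := by
    rw [← hunion, Finset.union_sdiff_cancel_right hdisj]
  have hSA : S \ (P ∪ R ∪ (W \ attached W Q)) = Q ∪ R' ∪ attached W Q := by
    rw [← hunion, Finset.union_sdiff_cancel_left hdisj]
  have hQne : Q.Nonempty := let ⟨e, he, _⟩ := mem_support.1 hv; ⟨e, he⟩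
  have hPne : P.Nonempty := let ⟨e, he, _⟩ := mem_support.1 hP.left_mem; ⟨e, he⟩
  refine ⟨_, _, hdisj, hunion, ?_, ?_, ?_, ?_, ?_, hBe, he, ?_⟩
  · exact hPne.mono (by intro e; simp; tauto)
  · exact hQne.mono (by intro e; simp; tauto)
  · refine connOn_of_separated hS (hP.1.union hR.1 hP.left_mem hR.left_mem)
      (hPne.mono Finset.subset_union_left) Finset.subset_union_left
      (by rw [← hunion]; exact Finset.subset_union_left) fun u hu hu' => ?_
    rw [hSA, support_union, support_union, Finset.mem_union, Finset.mem_union] at hu'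
    have hu2 : u ∈ G.support (W \ attached W Q) := by
      refine support_mono ?_ hu
      intro e
      simp only [Finset.mem_sdiff, Finset.mem_union]
      tauto
    have h1 := notMem_support_of_mem_sdiff_attached hu2
    have h2 := Finset.disjoint_left.1 hWR' (support_mono Finset.sdiff_subset hu2)
    tauto
  · have h1 := (hQ.1.union_attached W).union hR'.1 (x := x)
      (support_mono Finset.subset_union_left hQ.left_mem) hR'.left_mem
    rwa [Finset.union_right_comm] at h1
  · rw [← hAS]
    exact hSe.sdiff hBe (by rw [← hunion]; exact Finset.subset_union_right)
  · exact support_mono (by intro e; simp; tauto) hv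

theorem odd_compEdges_of_not_splits {S C : Finset G.E} {v x : G.V} (hS : G.ConnOn S)
    (hSe : EvenDeg S) (hC : G.IsCircuit C) (hCS : C ⊆ S) (hv : v ∈ G.support C)
    (hx : x ∈ G.support (S \ C)) (h : ¬ Splits S v) :
    ¬ Even (G.negEdges (G.compEdges (S \ C) x)).card := by
  intro he
  have hsub := compEdges_subset (S \ C) x
  have hsubS := hsub.trans Finset.sdiff_subset
  have hKe := (hSe.sdiff hC.evenDeg hCS).compEdges x
  obtain ⟨e, hex, -⟩ := mem_support.1 (mem_support_compEdges hx Relation.ReflTransGen.refl)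
  have hCK : C ⊆ S \ G.compEdges (S \ C) x := fun e he =>
    Finset.mem_sdiff.2 ⟨hCS he, fun h' => (Finset.mem_sdiff.1 (hsub h')).2 he⟩
  exact h ⟨_, _, Finset.disjoint_sdiff, Finset.union_sdiff_of_subset hsubS, ⟨e, hex⟩,
    hC.1.mono hCK, connOn_compEdges _ _, connOn_sdiff_compEdges hS hC.2.1 hC.1 hCS x, hKe,
    hSe.sdiff hKe hsubS, he, support_mono hCK hv⟩

theorem eq_of_not_splits {S C : Finset G.E} {v x w : G.V} (hS : G.ConnOn S)
    (hSe : EvenDeg S) (hC : G.IsCircuit C) (hCS : C ⊆ S) (hv : v ∈ G.support C)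
    (hxC : x ∈ G.support C) (hx : x ∈ G.support (S \ C)) (h : ¬ Splits S v)
    (hwC : w ∈ G.support C) (hw : w ∈ G.support (G.compEdges (S \ C) x)) : w = x := by
  by_contra hwx
  have hodd := odd_compEdges_of_not_splits hS hSe hC hCS hv hx h
  have hxK := mem_support_compEdges hx Relation.ReflTransGen.refl
  have hsub := compEdges_subset (S \ C) x
  have hSCe := hSe.sdiff hC.evenDeg hCS
  have hKe := hSCe.compEdges x
  have hWe := hSCe.sdiff hKe hsub
  have hKW := support_compEdges_disjoint (S \ C) x
  have hKc := connOn_compEdges (S \ C) x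
  generalize G.compEdges (S \ C) x = K at *
  obtain ⟨R₁, R₂, hR, hRK, hR₁, hR₂⟩ := exists_join_split hKc hKe hxK hw (Ne.symm hwx)
  obtain ⟨P, Q, hPQ, hPQC, hP, hQ, hvQ⟩ : ∃ P Q, Disjoint P Q ∧ P ∪ Q = C ∧ IsJoin P x w ∧
      IsJoin Q x w ∧ v ∈ G.support Q := by
    obtain ⟨P, Q, hPQ, hPQC, hP, hQ⟩ := exists_join_split hC.2.1 hC.evenDeg hxC hwC (Ne.symm hwx)
    rw [← hPQC, support_union, Finset.mem_union] at hv
    rcases hv with hv | hv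
    · exact ⟨Q, P, hPQ.symm, by rw [Finset.union_comm, hPQC], hQ, hP, hv⟩
    · exact ⟨P, Q, hPQ, hPQC, hP, hQ, hv⟩
  have hCK : Disjoint C K := Finset.disjoint_of_subset_right hsub Finset.disjoint_sdiff
  have hCW : Disjoint C ((S \ C) \ K) :=
    Finset.disjoint_of_subset_right Finset.sdiff_subset Finset.disjoint_sdiff
  have hPC : P ⊆ C := hPQC ▸ Finset.subset_union_left
  have hQC : Q ⊆ C := hPQC ▸ Finset.subset_union_right
  have hRK₁ : R₁ ⊆ K := hRK ▸ Finset.subset_union_left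
  have hRK₂ : R₂ ⊆ K := hRK ▸ Finset.subset_union_right
  have hSu : S = C ∪ K ∪ ((S \ C) \ K) := by
    ext e
    simp only [Finset.mem_union, Finset.mem_sdiff]
    have h1 := @hCS e
    have h2 := @hsub e
    simp only [Finset.mem_sdiff] at h2
    tauto
  have hd : ∀ {A B : Finset G.E}, A ⊆ C → B ⊆ K → Disjoint A B := fun hA hB =>
    Finset.disjoint_of_subset_left hA (Finset.disjoint_of_subset_right hB hCK)
  generalize hWdef : (S \ C) \ K = W at *
  have hdW : ∀ {A : Finset G.E}, A ⊆ C → Disjoint W A := fun hA =>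
    (Finset.disjoint_of_subset_left hA hCW).symm
  have hsW : ∀ {B : Finset G.E}, B ⊆ K → Disjoint (G.support W) (G.support B) := fun hB =>
    (Finset.disjoint_of_subset_left (support_mono hB) hKW).symm
  have h1 : ¬ Even (G.negEdges (P ∪ R₁ ∪ (W \ attached W Q))).card := fun he =>
    h (splits_of_joins hS hSe hP hQ hR₁ hR₂ hWe hPQ (hd hPC hRK₂) (hd hQC hRK₁) (hd hQC hRK₂) hR
      (hdW hPC) (hdW hQC) (hsW hRK₁) (hsW hRK₂)
      (by rw [hSu, ← hPQC, ← hRK, Finset.union_union_union_comm]) hvQ he)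
  have h2 : ¬ Even (G.negEdges (P ∪ R₂ ∪ (W \ attached W Q))).card := fun he =>
    h (splits_of_joins hS hSe hP hQ hR₂ hR₁ hWe hPQ (hd hPC hRK₁) (hd hQC hRK₂) (hd hQC hRK₁)
      hR.symm (hdW hPC) (hdW hQC) (hsW hRK₂) (hsW hRK₁)
      (by rw [hSu, ← hPQC, ← hRK, Finset.union_comm R₁, Finset.union_union_union_comm]) hvQ he)
  have hneg : ∀ {R : Finset G.E}, R ⊆ K → (G.negEdges (P ∪ R ∪ (W \ attached W Q))).card =
      (G.negEdges P).card + (G.negEdges R).card + (G.negEdges (W \ attached W Q)).card := by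
    intro R hRK
    rw [negEdges_union, negEdges_union (hd hPC hRK)]
    refine (Finset.disjoint_of_subset_left Finset.sdiff_subset ?_).symm
    rw [Finset.disjoint_union_right]
    exact ⟨hdW hPC, disjoint_of_disjoint_support (hsW hRK)⟩
  rw [hneg hRK₁] at h1
  rw [hneg hRK₂] at h2
  rw [← hRK, negEdges_union hR] at hodd
  simp only [Nat.even_iff] at h1 h2 hodd
  omega

theorem exists_reach_sdiff {S C : Finset G.E} {u t : G.V} (h : G.Reach S u t)
    (ht : t ∈ G.support C) : ∃ x ∈ G.support C, G.Reach (S \ C) u x := by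
  induction h using Relation.ReflTransGen.head_induction_on with
  | refl => exact ⟨t, ht, Relation.ReflTransGen.refl⟩
  | @head a b hab _ ih =>
    obtain ⟨e, he, hee⟩ := hab
    by_cases heC : e ∈ C
    · exact ⟨a, mem_support.2 ⟨e, heC, by simp [hee]⟩, Relation.ReflTransGen.refl⟩
    · obtain ⟨x, hx, hr⟩ := ih
      exact ⟨x, hx, Relation.ReflTransGen.head ⟨e, Finset.mem_sdiff.2 ⟨he, heC⟩, hee⟩ hr⟩

theorem mem_support_of_reach {S : Finset G.E} {u x : G.V} (hu : u ∈ G.support S)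
    (h : G.Reach S u x) : x ∈ G.support S := by
  cases h with
  | refl => exact hu
  | tail _ h =>
    obtain ⟨e, he, hee⟩ := h
    exact mem_support.2 ⟨e, he, by simp [hee]⟩

theorem sum_ind_eq {X : Finset G.V} {K : G.V → Finset G.E} {S : Finset G.E}
    (hd : ∀ x ∈ X, ∀ z ∈ X, x ≠ z → Disjoint (K x) (K z))
    (h : ∀ e, e ∈ S ↔ ∃ x ∈ X, e ∈ K x) (e : G.E) : ∑ x ∈ X, ind (K x) e = ind S e := by
  by_cases he : e ∈ S
  · obtain ⟨x, hx, hex⟩ := (h e).1 he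
    rw [Finset.sum_eq_single_of_mem x hx, ind_of_mem hex, ind_of_mem he]
    exact fun z hz hzx => ind_of_notMem fun hez =>
      Finset.disjoint_left.1 (hd z hz x hx hzx) hez hex
  · rw [ind_of_notMem he]
    exact Finset.sum_eq_zero fun x hx => ind_of_notMem fun hex => he ((h e).2 ⟨x, hx, hex⟩)

/-- Signed circuits that together cover every edge of `S` twice. -/
def HasDoubleCover (S : Finset G.E) : Prop :=
  ∃ F : Multiset (Finset G.E), (∀ T ∈ F, G.IsSignedCircuit T) ∧
    ∀ e, G.coverCount F e = 2 * ind S e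

theorem HasDoubleCover.union {A B : Finset G.E} (hA : HasDoubleCover A) (hB : HasDoubleCover B)
    (h : Disjoint A B) : HasDoubleCover (A ∪ B) := by
  obtain ⟨F, hF, hFe⟩ := hA
  obtain ⟨F', hF', hFe'⟩ := hB
  refine ⟨F + F', fun T hT => (Multiset.mem_add.1 hT).elim (hF T) (hF' T), fun e => ?_⟩
  rw [coverCount_add, hFe, hFe', ind_union h]
  ring

theorem HasDoubleCover.union_hasTadpoleCover {A B : Finset G.E} {v : G.V}
    (hA : HasDoubleCover A) (hB : HasTadpoleCover B v) (h : Disjoint A B) :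
    HasTadpoleCover (A ∪ B) v := by
  obtain ⟨F, hF, hFe⟩ := hA
  obtain ⟨F', T, T', hF', hT, hT', hFe'⟩ := hB
  refine ⟨F + F', T, T', fun R hR => (Multiset.mem_add.1 hR).elim (hF R) (hF' R), hT, hT',
    fun e => ?_⟩
  have := hFe' e
  rw [coverCount_add, hFe, ind_union h]
  omega

theorem HasTadpoleCover.hasDoubleCover_union {A B : Finset G.E} {v : G.V}
    (hA : HasTadpoleCover A v) (hB : HasTadpoleCover B v) (h : Disjoint A B)
    (hv : ∀ z ∈ G.support A, z ∈ G.support B → z = v) : HasDoubleCover (A ∪ B) := by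
  obtain ⟨F, T, T', hF, hT, hT', hFe⟩ := hA
  obtain ⟨F', U, U', hF', hU, hU', hFe'⟩ := hB
  obtain ⟨hTA, hTA'⟩ := subset_of_tadpole_cover hFe
  obtain ⟨hUB, hUB'⟩ := subset_of_tadpole_cover hFe'
  have hd := Finset.disjoint_of_subset_left hTA (Finset.disjoint_of_subset_right hUB h)
  have hd' := Finset.disjoint_of_subset_left hTA' (Finset.disjoint_of_subset_right hUB' h)
  have h1 := hT.isSignedCircuit_union hU
    (fun z hz hz' => hv z (support_mono hTA hz) (support_mono hUB hz')) hd
  have h2 := hT'.isSignedCircuit_union hU'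
    (fun z hz hz' => hv z (support_mono hTA' hz) (support_mono hUB' hz')) hd'
  refine ⟨F + F' + {T ∪ U} + {T' ∪ U'}, fun R hR => ?_, fun e => ?_⟩
  · simp only [Multiset.mem_add, Multiset.mem_singleton] at hR
    rcases hR with ((hR | hR) | rfl) | rfl
    exacts [hF R hR, hF' R hR, h1, h2]
  · have e1 := hFe e
    have e2 := hFe' e
    rw [coverCount_add, coverCount_add, coverCount_add, coverCount_singleton,
      coverCount_singleton, ind_union hd, ind_union hd', ind_union h]
    omega

theorem IsBalancedCircuit.hasDoubleCover {C : Finset G.E} (hC : G.IsBalancedCircuit C) :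
    HasDoubleCover C := by
  refine ⟨{C} + {C}, fun R hR => ?_, fun e => ?_⟩
  · simp only [Multiset.mem_add, Multiset.mem_singleton, or_self] at hR
    exact hR ▸ Or.inl hC
  · rw [coverCount_add, coverCount_singleton]
    ring

theorem hasDoubleCover_empty : HasDoubleCover (∅ : Finset G.E) :=
  ⟨0, by simp, fun e => by rw [coverCount_zero, ind_of_notMem (Finset.notMem_empty e)]⟩

theorem not_splits_of_even_cover {S : Finset G.E} {v : G.V}
    (ih : ∀ A : Finset G.E, A.card < S.card → G.ConnOn A → EvenDeg A →
      Even (G.negEdges A).card → HasDoubleCover A)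
    (hne : Even (G.negEdges S).card) (h : ¬ HasDoubleCover S) : ¬ Splits S v := by
  rintro ⟨A, B, hd, rfl, hAn, hBn, hA, hB, hAe, hBe, hAeven, -⟩
  have hc := Finset.card_union_of_disjoint hd
  have := hAn.card_pos
  have := hBn.card_pos
  rw [negEdges_union hd, Nat.even_add] at hne
  exact h ((ih A (by omega) hA hAe hAeven).union (ih B (by omega) hB hBe (hne.1 hAeven)) hd)

theorem hasDoubleCover_of_ih {S : Finset G.E} (hS : G.ConnOn S) (hSe : EvenDeg S)
    (ih : ∀ A : Finset G.E, A.card < S.card → G.ConnOn A → EvenDeg A →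
      Even (G.negEdges A).card → HasDoubleCover A)
    (ih' : ∀ A : Finset G.E, A.card < S.card → G.ConnOn A → EvenDeg A →
      ¬ Even (G.negEdges A).card → ∀ v ∈ G.support A, HasTadpoleCover A v)
    (hne : Even (G.negEdges S).card) : HasDoubleCover S := by
  by_contra hcov
  rcases S.eq_empty_or_nonempty with rfl | hSn
  · exact hcov hasDoubleCover_empty
  obtain ⟨v, hv⟩ := support_nonempty hSn
  have hspl : ¬ Splits S v := not_splits_of_even_cover ih hne hcov
  obtain ⟨C, hCS, hC, hvC⟩ := exists_isCircuit hSe hv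
  by_cases hCS' : S ⊆ C
  · obtain rfl := Finset.Subset.antisymm hCS hCS'
    exact hcov (IsBalancedCircuit.hasDoubleCover ⟨hC, hne⟩)
  obtain ⟨e, heS, heC⟩ := Finset.not_subset.1 hCS'
  obtain ⟨u, hu⟩ := exists_mem_ends e
  have heSC : e ∈ S \ C := Finset.mem_sdiff.2 ⟨heS, heC⟩
  have huS : u ∈ G.support (S \ C) := mem_support.2 ⟨e, heSC, hu⟩
  obtain ⟨x, hxC, hr⟩ := exists_reach_sdiff
    (hS u (support_mono Finset.sdiff_subset huS) v hv) hvC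
  have hx := mem_support_of_reach huS hr
  have hodd := odd_compEdges_of_not_splits hS hSe hC hCS hvC hx hspl
  have hsub := compEdges_subset (S \ C) x
  have hKS := hsub.trans Finset.sdiff_subset
  have hKe := (hSe.sdiff hC.evenDeg hCS).compEdges x
  have hCK : C ⊆ S \ G.compEdges (S \ C) x := fun e he =>
    Finset.mem_sdiff.2 ⟨hCS he, fun h' => (Finset.mem_sdiff.1 (hsub h')).2 he⟩
  have hxK := mem_support_compEdges hx Relation.ReflTransGen.refl
  obtain ⟨f, hfK, -⟩ := mem_support.1 hxK
  have hcard := Finset.card_sdiff_add_card_eq_card hKS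
  have hCcard := (hC.1.mono hCK).card_pos
  have hKcard := Finset.card_pos.2 ⟨f, hfK⟩
  have hnegs := negEdges_sdiff (G := G) hKS
  have hodd' : ¬ Even (G.negEdges (S \ G.compEdges (S \ C) x)).card := by
    rw [← hnegs, Nat.even_add] at hne
    exact fun h => hodd (hne.1 h)
  have h1 := ih' _ (by omega) (connOn_compEdges (S \ C) x) hKe hodd x hxK
  have h2 := ih' _ (by omega) (connOn_sdiff_compEdges hS hC.2.1 hC.1 hCS x)
    (hSe.sdiff hKe hKS) hodd' x (support_mono hCK hxC)
  have h3 := h1.hasDoubleCover_union h2 Finset.disjoint_sdiff fun z hz hz' => by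
    obtain ⟨g, hg, hzg⟩ := mem_support.1 hz'
    rw [Finset.mem_sdiff] at hg
    by_cases hgC : g ∈ C
    · exact eq_of_not_splits hS hSe hC hCS hvC hxC hx hspl (mem_support.2 ⟨g, hgC, hzg⟩) hz
    · exact absurd (mem_support.2 ⟨g, Finset.mem_sdiff.2
        ⟨Finset.mem_sdiff.2 ⟨hg.1, hgC⟩, hg.2⟩, hzg⟩)
        (Finset.disjoint_left.1 (support_compEdges_disjoint (S \ C) x) hz)
  rw [Finset.union_sdiff_of_subset hKS] at h3
  exact hcov h3

theorem hasTadpoleCover_of_ih {S : Finset G.E} (hS : G.ConnOn S) (hSe : EvenDeg S)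
    (ih : ∀ A : Finset G.E, A.card < S.card → G.ConnOn A → EvenDeg A →
      Even (G.negEdges A).card → HasDoubleCover A)
    (ih' : ∀ A : Finset G.E, A.card < S.card → G.ConnOn A → EvenDeg A →
      ¬ Even (G.negEdges A).card → ∀ v ∈ G.support A, HasTadpoleCover A v)
    (hne : ¬ Even (G.negEdges S).card) {v : G.V} (hv : v ∈ G.support S) :
    HasTadpoleCover S v := by
  by_cases hspl : Splits S v
  · obtain ⟨A, B, hd, rfl, hAn, hBn, hA, hB, hAe, hBe, hAeven, hvB⟩ := hspl
    have hc := Finset.card_union_of_disjoint hd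
    have := hAn.card_pos
    have := hBn.card_pos
    rw [negEdges_union hd, Nat.even_add] at hne
    exact (ih A (by omega) hA hAe hAeven).union_hasTadpoleCover
      (ih' B (by omega) hB hBe (fun h => hne (iff_of_true hAeven h)) v hvB) hd
  obtain ⟨C, hCS, hC, hvC⟩ := exists_isCircuit hSe hv
  have hSCe := hSe.sdiff hC.evenDeg hCS
  have hcard := Finset.card_sdiff_add_card_eq_card hCS
  have hCcard := hC.1.card_pos
  have hnegC := negEdges_sdiff (G := G) hCS
  set X := G.support C ∩ G.support (S \ C) with hX
  set K := fun x => G.compEdges (S \ C) x with hK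
  have hXmem : ∀ x ∈ X, x ∈ G.support C ∧ x ∈ G.support (S \ C) := fun x hx =>
    Finset.mem_inter.1 hx
  have hsub : ∀ x, K x ⊆ S \ C := compEdges_subset (S \ C)
  have hxK : ∀ x ∈ X, x ∈ G.support (K x) := fun x hx =>
    mem_support_compEdges (hXmem x hx).2 Relation.ReflTransGen.refl
  have hodd : ∀ x ∈ X, ¬ Even (G.negEdges (K x)).card := fun x hx =>
    odd_compEdges_of_not_splits hS hSe hC hCS hvC (hXmem x hx).2 hspl
  have hKC : ∀ x ∈ X, ∀ z ∈ G.support (K x), z ∈ G.support C → z = x := fun x hx z hz hzC =>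
    eq_of_not_splits hS hSe hC hCS hvC (hXmem x hx).1 (hXmem x hx).2 hspl hzC hz
  have hKe : ∀ x, EvenDeg (K x) := hSCe.compEdges
  have hvX : v ∉ X := by
    intro hvX
    have hKS := (hsub v).trans Finset.sdiff_subset
    obtain ⟨f, hfK, -⟩ := mem_support.1 (hxK v hvX)
    have hCK : C ⊆ S \ K v := fun e he =>
      Finset.mem_sdiff.2 ⟨hCS he, fun h' => (Finset.mem_sdiff.1 (hsub v h')).2 he⟩
    have hnegs := negEdges_sdiff (G := G) hKS
    rw [← hnegs, Nat.even_add] at hne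
    have := hodd v hvX
    exact hspl ⟨S \ K v, K v, Finset.sdiff_disjoint, Finset.sdiff_union_of_subset hKS,
      hC.1.mono hCK, ⟨f, hfK⟩, connOn_sdiff_compEdges hS hC.2.1 hC.1 hCS v,
      connOn_compEdges _ _, hSe.sdiff (hKe v) hKS, hKe v, by tauto, hxK v hvX⟩
  have hKK : ∀ x ∈ X, ∀ z ∈ X, x ≠ z → Disjoint (G.support (K x)) (G.support (K z)) := by
    intro x hx z hz hxz
    rw [Finset.disjoint_left]
    intro y hy hy'
    have hr := (reach_of_mem_support_compEdges hy).trans (reach_of_mem_support_compEdges hy').symm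
    exact hxz (hKC x hx z (mem_support_compEdges (hXmem z hz).2 hr) (hXmem z hz).1).symm
  have hcover : ∀ e, e ∈ S \ C ↔ ∃ x ∈ X, e ∈ K x := by
    refine fun e => ⟨fun he => ?_, fun ⟨x, _, hex⟩ => hsub x hex⟩
    obtain ⟨u, hu⟩ := exists_mem_ends e
    have huS : u ∈ G.support (S \ C) := mem_support.2 ⟨e, he, hu⟩
    obtain ⟨x, hxC, hr⟩ := exists_reach_sdiff
      (hS u (support_mono Finset.sdiff_subset huS) v hv) hvC
    exact ⟨x, Finset.mem_inter.2 ⟨hxC, mem_support_of_reach huS hr⟩,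
      mem_compEdges_of_reach he hu hr.symm⟩
  obtain ⟨F, T, T', hF, hT, hT', hFe⟩ := exists_circuit_cover hC hvC (X := X) (K := K)
    (fun x hx => ⟨(hXmem x hx).1, fun h => hvX (h ▸ hx)⟩)
    (fun x hx => ih' (K x) (by have := Finset.card_le_card (hsub x); omega) (connOn_compEdges _ _)
      (hKe x) (hodd x hx) x (hxK x hx))
    hKC (fun x _ => Finset.disjoint_of_subset_left (hsub x) Finset.sdiff_disjoint) hKK
    (fun h0 => by
      have h1 : S \ C = ∅ := Finset.eq_empty_of_forall_notMem fun e he => by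
        obtain ⟨x, hx, -⟩ := (hcover e).1 he
        rw [h0] at hx
        exact Finset.notMem_empty x hx
      rwa [Finset.Subset.antisymm (Finset.sdiff_eq_empty_iff_subset.1 h1) hCS] at hne)
    (fun x h1 => by
      have hxX : x ∈ X := h1 ▸ Finset.mem_singleton_self x
      have h2 : S \ C = K x := Finset.ext fun e => by rw [hcover, h1]; simp
      have h3 := hodd x hxX
      rw [h2] at hnegC
      rw [← hnegC, Nat.even_add] at hne
      tauto)
  refine ⟨F, T, T', hF, hT, hT', fun e => ?_⟩
  rw [hFe, sum_ind_eq (fun x hx z hz h => disjoint_of_disjoint_support (hKK x hx z hz h)) hcover,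
    ← ind_union Finset.disjoint_sdiff, Finset.union_sdiff_of_subset hCS]

theorem exists_covers (n : ℕ) (S : Finset G.E) (hn : S.card = n) (hS : G.ConnOn S)
    (hSe : EvenDeg S) : (Even (G.negEdges S).card → HasDoubleCover S) ∧
      (¬ Even (G.negEdges S).card → ∀ v ∈ G.support S, HasTadpoleCover S v) := by
  induction n using Nat.strong_induction_on generalizing S with
  | _ n ih =>
    subst hn
    have h1 := fun A hc hA hAe => (ih _ hc A rfl hA hAe).1
    have h2 := fun A hc hA hAe => (ih _ hc A rfl hA hAe).2
    exact ⟨hasDoubleCover_of_ih hS hSe h1 h2, fun hne v hv =>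
      hasTadpoleCover_of_ih hS hSe h1 h2 hne hv⟩

end SignedMultigraph

/-- Every signed eulerian graph containing an even number of
negative edges has a signed circuit double cover. -/
theorem eulerian_signed_circuit_double_cover (G : SignedMultigraph)
    (heul : G.Eulerian) (heven : Even (G.negEdges Finset.univ).card) :
    ∃ F : Multiset (Finset G.E),
      (∀ S ∈ F, G.IsSignedCircuit S) ∧ ∀ e : G.E, G.coverCount F e = 2 := by
  obtain ⟨F, hF, hFe⟩ := (SignedMultigraph.exists_covers _ Finset.univ rfl
    (fun u _ v _ => heul.1.2 u v) heul.2).1 heven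
  exact ⟨F, hF, fun e => by rw [hFe, SignedMultigraph.ind_of_mem (Finset.mem_univ e)]⟩
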